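/- arXiv:1205.6056 — 3 statements merged into one kernel-verified Lean document; each statement's English description precedes it below -/
import Mathlib

section
/- For k = 10 and every integer n ≥ 5, the number of parameter tuples whose associated n-times persymmetric 2n×10 matrix over 𝔽₂ has rank 8 is Γ_8(n,10) = 511·2^{8n} + 171955·2^{7n} − 897890·2^{6n} − 38376240·2^{5n} + 323250144·2^{4n} + 271514880·2^{3n} − 436135·2^{14}·2^{2n} + 242795·2^{16}·2^n − 4445·2^{21} (an identity of integers). -/
open Finset

/-- The `2n × k` n-times persymmetric matrix over `F_2` associated to a parameter tuple
`alpha ∈ (F_2^{k+1})^n` : for `1 ≤ j ≤ n`, rows `2j-1` and `2j` are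
`(alpha^(j)_1, ..., alpha^(j)_k)` and `(alpha^(j)_2, ..., alpha^(j)_{k+1})`. -/
def persymMatrix (n k : ℕ) (α : Fin n → Fin (k + 1) → ZMod 2) :
    Matrix (Fin (2 * n)) (Fin k) (ZMod 2) :=
  Matrix.of fun r c =>
    α ⟨r.val / 2, by have := r.isLt; omega⟩ ⟨r.val % 2 + c.val, by have := c.isLt; omega⟩

/-- `Gamma n k i` is the number of parameter tuples `alpha ∈ (F_2^{k+1})^n` whose associated
n-times persymmetric `2n × k` matrix over `F_2` has rank `i`. -/
noncomputable def Gamma (n k i : ℕ) : ℕ :=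
  Nat.card {α : Fin n → Fin (k + 1) → ZMod 2 // (persymMatrix n k α).rank = i}

/-- Gaussian binomial coefficients at `q = 2`. -/
def gb : ℕ → ℕ → ℕ
  | _, 0 => 1
  | 0, _ + 1 => 0
  | n + 1, d + 1 => gb n d + 2 ^ (d + 1) * gb n (d + 1)

theorem gb_eq_zero : ∀ (n d : ℕ), n < d → gb n d = 0
  | _, 0, h => by omega
  | 0, _ + 1, _ => rfl
  | n + 1, d + 1, h => by
    rw [gb, gb_eq_zero n d (by omega), gb_eq_zero n (d + 1) (by omega), Nat.mul_zero]

theorem gb_prod : ∀ n < 12, ∀ d < 12, d ≤ n →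
    gb n d * ∏ i : Fin d, (2 ^ d - 2 ^ i.val) = ∏ i : Fin d, (2 ^ n - 2 ^ i.val) := by
  have h : ∀ n < 12, ∀ d < 12, d ≤ n →
      gb n d * ∏ i ∈ Finset.range d, (2 ^ d - 2 ^ i) = ∏ i ∈ Finset.range d, (2 ^ n - 2 ^ i) := by
    decide +kernel
  intro n hn d hd hdn
  rw [Fin.prod_univ_eq_prod_range (fun i => 2 ^ d - 2 ^ i),
    Fin.prod_univ_eq_prod_range (fun i => 2 ^ n - 2 ^ i)]
  exact h n hn d hd hdn

/-- The number of subspaces of dimension `d` is the Gaussian binomial coefficient. -/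
theorem card_subspaces {U : Type*} [AddCommGroup U] [Module (ZMod 2) U] [Finite U] (d : ℕ)
    (hU : Module.finrank (ZMod 2) U < 12) :
    Nat.card {W : Submodule (ZMod 2) U // Module.finrank (ZMod 2) W = d} =
      gb (Module.finrank (ZMod 2) U) d := by
  rcases lt_or_ge (Module.finrank (ZMod 2) U) d with h | h
  · rw [gb_eq_zero _ _ h]
    have : IsEmpty {W : Submodule (ZMod 2) U // Module.finrank (ZMod 2) W = d} := by
      refine ⟨fun W => ?_⟩
      have := Submodule.finrank_le W.1
      have := W.2
      omega
    simp
  · have h1 := card_linearIndependent (K := ZMod 2) (V := U) h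
    have hpos : 0 < ∏ i : Fin d, (2 ^ d - 2 ^ i.val) := by
      refine Finset.prod_pos fun i _ => ?_
      have : 2 ^ i.val < 2 ^ d := Nat.pow_lt_pow_right (by norm_num) i.2
      omega
    have key : Nat.card {s : Fin d → U // LinearIndependent (ZMod 2) s} =
        Nat.card (Σ W : {W : Submodule (ZMod 2) U // Module.finrank (ZMod 2) W = d},
          {s : Fin d → W.1 // LinearIndependent (ZMod 2) s}) := by
      symm
      refine Nat.card_congr (Equiv.ofBijective
        (fun x => ⟨fun i => (x.2.1 i : U),
          x.2.2.map' x.1.1.subtype (Submodule.ker_subtype _)⟩) ⟨?_, ?_⟩)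
      · have hspan : ∀ x : (Σ W : {W : Submodule (ZMod 2) U // Module.finrank (ZMod 2) W = d},
          {s : Fin d → W.1 // LinearIndependent (ZMod 2) s}),
            Submodule.span (ZMod 2) (Set.range fun i => (x.2.1 i : U)) = x.1.1 := by
          intro x
          apply Submodule.eq_of_le_of_finrank_eq
          · rw [Submodule.span_le]
            rintro _ ⟨i, rfl⟩
            exact (x.2.1 i).2
          · have := finrank_span_eq_card (x.2.2.map' x.1.1.subtype (Submodule.ker_subtype _))
            rw [x.1.2]
            rw [Fintype.card_fin] at this
            exact this
        rintro ⟨⟨W, hW⟩, s, hs⟩ ⟨⟨W', hW'⟩, s', hs'⟩ hxy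
        have e := congrArg Subtype.val hxy
        simp only at e
        have a := hspan ⟨⟨W, hW⟩, s, hs⟩
        have b := hspan ⟨⟨W', hW'⟩, s', hs'⟩
        simp only at a b
        rw [e, b] at a
        subst a
        have : s = s' := by
          funext i
          exact Subtype.ext (congrFun e i)
        subst this
        rfl
      · rintro ⟨s, hs⟩
        refine ⟨⟨⟨Submodule.span (ZMod 2) (Set.range s), ?_⟩,
          fun i => ⟨s i, Submodule.subset_span ⟨i, rfl⟩⟩, ?_⟩, rfl⟩
        · rw [finrank_span_eq_card hs]; simp
        · exact LinearIndependent.of_comp (Submodule.subtype _) hs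
    have := Fintype.ofFinite {W : Submodule (ZMod 2) U // Module.finrank (ZMod 2) W = d}
    rw [Nat.card_sigma] at key
    have h2 : ∀ W : {W : Submodule (ZMod 2) U // Module.finrank (ZMod 2) W = d},
        Nat.card {s : Fin d → W.1 // LinearIndependent (ZMod 2) s} =
          ∏ i : Fin d, (2 ^ d - 2 ^ i.val) := by
      intro W
      rw [card_linearIndependent (K := ZMod 2) (V := W.1) W.2.ge, W.2]
      simp [ZMod.card]
    simp only [h2] at key
    rw [h1, Finset.sum_const, Finset.card_univ, ZMod.card, ← Nat.card_eq_fintype_card, smul_eq_mul,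
      ← gb_prod _ hU d (by omega) h] at key
    exact (Nat.eq_of_mul_eq_mul_right hpos key).symm

/-- The number of subspaces of dimension `d` between two given ones. -/
theorem card_between {V : Type*} [AddCommGroup V] [Module (ZMod 2) V] [Finite V]
    (E U : Submodule (ZMod 2) V) (hEU : E ≤ U) (d : ℕ)
    (hU : Module.finrank (ZMod 2) U < 12) :
    Nat.card {W : Submodule (ZMod 2) V // E ≤ W ∧ W ≤ U ∧ Module.finrank (ZMod 2) W = d} =
      if Module.finrank (ZMod 2) E ≤ d then
        gb (Module.finrank (ZMod 2) U - Module.finrank (ZMod 2) E)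
          (d - Module.finrank (ZMod 2) E) else 0 := by
  split_ifs with h
  · set E' : Submodule (ZMod 2) U := E.comap U.subtype with hE'
    have hmapE : E'.map U.subtype = E := by
      rw [hE', Submodule.map_comap_subtype, inf_eq_right.2 hEU]
    have hE'r : Module.finrank (ZMod 2) E' = Module.finrank (ZMod 2) E := by
      rw [← hmapE, Submodule.finrank_map_subtype_eq]
    have hq := Submodule.finrank_quotient_add_finrank E'
    have hfin : ∀ X : Submodule (ZMod 2) (U ⧸ E'),
        Module.finrank (ZMod 2) ((X.comap E'.mkQ).map U.subtype) =
          Module.finrank (ZMod 2) X + Module.finrank (ZMod 2) E := by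
      intro X
      rw [Submodule.finrank_map_subtype_eq]
      have hr := LinearMap.finrank_range_add_finrank_ker
        (E'.mkQ.domRestrict (X.comap E'.mkQ))
      rw [LinearMap.range_domRestrict, Submodule.map_comap_eq_of_surjective
        (Submodule.mkQ_surjective _), LinearMap.ker_domRestrict, Submodule.ker_mkQ] at hr
      rw [← hr, ← hE'r]
      congr 1
      rw [← Submodule.finrank_map_subtype_eq, Submodule.map_comap_subtype]
      rw [inf_eq_right.2 (Submodule.le_comap_mkQ E' X)]
    have hQ : Module.finrank (ZMod 2) (U ⧸ E') =
        Module.finrank (ZMod 2) U - Module.finrank (ZMod 2) E := by omega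
    have : Finite (U ⧸ E') := Finite.of_surjective _ (Submodule.mkQ_surjective E')
    rw [← hQ, ← card_subspaces (U := U ⧸ E') _ (by omega)]
    symm
    refine Nat.card_congr (Equiv.ofBijective
      (fun X => ⟨(X.1.comap E'.mkQ).map U.subtype, ?_, ?_, ?_⟩) ⟨?_, ?_⟩)
    · conv_lhs => rw [← hmapE]
      exact Submodule.map_mono (Submodule.le_comap_mkQ E' X.1)
    · exact Submodule.map_subtype_le _ _
    · rw [hfin, X.2]; omega
    · rintro ⟨X, hX⟩ ⟨Y, hY⟩ hXY
      have e := congrArg Subtype.val hXY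
      simp only at e
      have e2 := Submodule.map_injective_of_injective U.injective_subtype e
      exact Subtype.ext (Submodule.comap_injective_of_surjective
        (Submodule.mkQ_surjective _) e2)
    · rintro ⟨W, hEW, hWU, hWd⟩
      have hback : (((W.comap U.subtype).map E'.mkQ).comap E'.mkQ).map U.subtype = W := by
        rw [Submodule.comap_map_mkQ, sup_eq_right.2 (Submodule.comap_mono hEW),
          Submodule.map_comap_subtype, inf_eq_right.2 hWU]
      refine ⟨⟨(W.comap U.subtype).map E'.mkQ, ?_⟩, Subtype.ext hback⟩
      have := hfin ((W.comap U.subtype).map E'.mkQ)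
      rw [hback, hWd] at this
      omega
  · have : IsEmpty {W : Submodule (ZMod 2) V //
        E ≤ W ∧ W ≤ U ∧ Module.finrank (ZMod 2) W = d} := by
      refine ⟨fun W => h ?_⟩
      rw [← W.2.2.2]
      exact Submodule.finrank_mono W.2.1
    simp

/-- The ambient space: polynomials over `F_2` of degree at most `10`, as coefficient vectors. -/
abbrev VV : Type := Fin 11 → ZMod 2

/-- Multiplication by `x` (the top coefficient is lost). -/
def shift : VV →ₗ[ZMod 2] VV where
  toFun v := Fin.cons 0 (fun i : Fin 10 => v i.castSucc)
  map_add' u v := by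
    funext i
    refine Fin.cases ?_ (fun j => ?_) i <;> simp
  map_smul' c v := by
    funext i
    refine Fin.cases ?_ (fun j => ?_) i <;> simp

theorem shift_succ (v : VV) (i : Fin 10) : shift v i.succ = v i.castSucc := by
  simp [shift]

theorem shift_zero (v : VV) : shift v 0 = 0 := by
  simp [shift]

/-- Polynomials of degree less than `k`. -/
def Pk (k : ℕ) : Submodule (ZMod 2) VV where
  carrier := {v | ∀ i : Fin 11, k ≤ i.val → v i = 0}
  zero_mem' := by intro i _; rfl
  add_mem' := by
    intro u v hu hv i hi
    simp [hu i hi, hv i hi]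
  smul_mem' := by
    intro c v hv i hi
    simp [hv i hi]

theorem mem_Pk {k : ℕ} {v : VV} : v ∈ Pk k ↔ ∀ i : Fin 11, k ≤ i.val → v i = 0 := Iff.rfl

theorem Pk_mono {k l : ℕ} (h : k ≤ l) : Pk k ≤ Pk l := fun _ hv i hi => hv i (h.trans hi)

theorem Pk_zero : Pk 0 = ⊥ := by
  rw [eq_bot_iff]
  intro v hv
  rw [Submodule.mem_bot]
  funext i
  exact hv i (Nat.zero_le _)

/-- Extension by zero. -/
def ext0 (k : ℕ) : (Fin k → ZMod 2) →ₗ[ZMod 2] VV where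
  toFun v i := if h : i.val < k then v ⟨i.val, h⟩ else 0
  map_add' u v := by
    funext i
    by_cases h : i.val < k <;> simp [h]
  map_smul' c v := by
    funext i
    by_cases h : i.val < k <;> simp [h]

theorem ext0_apply (k : ℕ) (v : Fin k → ZMod 2) (i : Fin 11) :
    ext0 k v i = if h : i.val < k then v ⟨i.val, h⟩ else 0 := rfl

theorem ext0_inj {k : ℕ} (hk : k ≤ 11) : Function.Injective (ext0 k) := by
  intro u v h
  funext i
  have := congrFun h ⟨i.val, by omega⟩
  simpa [ext0_apply] using this

theorem ext0_range {k : ℕ} (hk : k ≤ 11) : LinearMap.range (ext0 k) = Pk k := by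
  ext v
  rw [LinearMap.mem_range, mem_Pk]
  constructor
  · rintro ⟨u, rfl⟩ i hi
    rw [ext0_apply, dif_neg (by omega)]
  · intro h
    refine ⟨fun i => v ⟨i.val, by omega⟩, ?_⟩
    funext i
    rw [ext0_apply]
    split_ifs with hi
    · rfl
    · exact (h i (by omega)).symm

theorem finrank_Pk {k : ℕ} (hk : k ≤ 11) : Module.finrank (ZMod 2) (Pk k) = k := by
  rw [← ext0_range hk, LinearMap.finrank_range_of_inj (ext0_inj hk)]
  simp

theorem shift_mem {k : ℕ} {v : VV} (hv : v ∈ Pk k) : shift v ∈ Pk (k + 1) := by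
  intro i
  refine Fin.cases ?_ (fun j => ?_) i
  · intro _; exact shift_zero v
  · intro h
    rw [shift_succ]
    apply hv
    simp at h ⊢
    exact h

theorem mem_of_shift_mem {k : ℕ} {v : VV} (h10 : v ∈ Pk 10) (hv : shift v ∈ Pk (k + 1)) :
    v ∈ Pk k := by
  intro i
  refine Fin.lastCases ?_ (fun j => ?_) i
  · intro _; exact h10 _ (by simp)
  · intro h
    rw [← shift_succ v j]
    apply hv
    simp at h ⊢
    exact h

theorem shift_inj_on {v : VV} (h10 : v ∈ Pk 10) (hv : shift v = 0) : v = 0 := by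
  have : v ∈ Pk 0 := mem_of_shift_mem h10 (by rw [hv]; exact Submodule.zero_mem _)
  rwa [Pk_zero, Submodule.mem_bot] at this

theorem finrank_map_shift {A : Submodule (ZMod 2) VV} (hA : A ≤ Pk 10) :
    Module.finrank (ZMod 2) (A.map shift) = Module.finrank (ZMod 2) A := by
  rw [← LinearMap.range_domRestrict]
  apply LinearMap.finrank_range_of_inj
  rw [← LinearMap.ker_eq_bot, eq_bot_iff]
  rintro ⟨v, hv⟩ h
  rw [Submodule.mem_bot]
  exact Subtype.ext (shift_inj_on (hA hv) h)

/-- `{w ∈ W : x w ∈ W}`. -/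
def core (W : Submodule (ZMod 2) VV) : Submodule (ZMod 2) VV := W ⊓ W.comap shift

/-- `W + x W`. -/
def hull (W : Submodule (ZMod 2) VV) : Submodule (ZMod 2) VV := W ⊔ W.map shift

theorem hull_le_iff (A W : Submodule (ZMod 2) VV) : hull A ≤ W ↔ A ≤ core W := by
  rw [hull, core, sup_le_iff, le_inf_iff, Submodule.map_le_iff_le_comap]

theorem finrank_hull {A : Submodule (ZMod 2) VV} (hA : A ≤ Pk 10) :
    Module.finrank (ZMod 2) (hull A) + Module.finrank (ZMod 2) (core A) =
      2 * Module.finrank (ZMod 2) A := by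
  have h := Submodule.finrank_sup_add_finrank_inf_eq A (A.map shift)
  rw [finrank_map_shift hA] at h
  have h2 : (core A).map shift = A ⊓ A.map shift := by
    ext w
    simp only [core, Submodule.mem_map, Submodule.mem_inf, Submodule.mem_comap]
    constructor
    · rintro ⟨v, ⟨h1, h2⟩, rfl⟩
      exact ⟨h2, v, h1, rfl⟩
    · rintro ⟨h1, v, h2, rfl⟩
      exact ⟨v, ⟨h2, h1⟩, rfl⟩
  rw [← finrank_map_shift (A := core A) (inf_le_left.trans hA), h2, hull]
  omega

theorem hull_le_Pk {k : ℕ} {A : Submodule (ZMod 2) VV} (hA : A ≤ Pk k) : hull A ≤ Pk (k + 1) := by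
  refine sup_le (hA.trans (Pk_mono (by omega))) ?_
  rintro _ ⟨v, hv, rfl⟩
  exact shift_mem (hA hv)

theorem core_le_Pk {k : ℕ} (hk : k < 10) {W : Submodule (ZMod 2) VV} (hW : W ≤ Pk (k + 1)) :
    core W ≤ Pk k := by
  rintro v ⟨h1, h2⟩
  exact mem_of_shift_mem (Pk_mono (by omega) (hW h1)) (hW h2)

theorem finrank_lt {k : ℕ} (hk : k ≤ 10) {W : Submodule (ZMod 2) VV} (hW : W ≤ Pk k) :
    Module.finrank (ZMod 2) W < 11 := by
  have := Submodule.finrank_mono hW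
  rw [finrank_Pk (by omega)] at this
  omega

open scoped Classical in
/-- Subspaces of dimension `d` of the space of polynomials of degree `< k`. -/
noncomputable def subs (k d : ℕ) : Finset (Submodule (ZMod 2) VV) :=
  Finset.univ.filter fun W => W ≤ Pk k ∧ Module.finrank (ZMod 2) W = d

theorem mem_subs {k d : ℕ} {W : Submodule (ZMod 2) VV} :
    W ∈ subs k d ↔ W ≤ Pk k ∧ Module.finrank (ZMod 2) W = d := by
  classical
  simp [subs]

open scoped Classical in
/-- Number of subspaces of dimension `d` whose core has dimension `b`. -/
noncomputable def cnt (k d b : ℕ) : ℕ :=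
  ((subs k d).filter fun W => Module.finrank (ZMod 2) (core W) = b).card

/-- Number of `d`-dimensional spaces between spaces of dimension `e` and `m`. -/
def hh (m e d : ℕ) : ℕ := if e ≤ d then gb (m - e) (d - e) else 0

open scoped Classical in
theorem card_filter_between (E U : Submodule (ZMod 2) VV) (hEU : E ≤ U) (d : ℕ) :
    (Finset.univ.filter fun W : Submodule (ZMod 2) VV =>
      E ≤ W ∧ W ≤ U ∧ Module.finrank (ZMod 2) W = d).card =
      hh (Module.finrank (ZMod 2) U) (Module.finrank (ZMod 2) E) d := by
  have hU : Module.finrank (ZMod 2) U < 12 := by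
    have := Submodule.finrank_le U
    simp at this
    omega
  rw [hh, ← card_between E U hEU d hU, Nat.card_eq_fintype_card, Fintype.card_subtype]

theorem sum_core {k d : ℕ} (hk : k ≤ 10) (f : ℕ → ℕ) :
    ∑ W ∈ subs k d, f (Module.finrank (ZMod 2) (core W)) =
      ∑ b ∈ Finset.range 11, cnt k d b * f b := by
  classical
  have hm : ∀ W ∈ subs k d, Module.finrank (ZMod 2) (core W) ∈ Finset.range 11 := by
    intro W hW
    rw [Finset.mem_range]
    exact finrank_lt hk (inf_le_left.trans (mem_subs.1 hW).1)
  rw [← Finset.sum_fiberwise_of_maps_to hm]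
  refine Finset.sum_congr rfl fun b _ => ?_
  rw [cnt, ← smul_eq_mul, ← Finset.sum_const]
  refine Finset.sum_congr rfl fun W hW => ?_
  rw [(Finset.mem_filter.1 hW).2]

theorem double_count {k : ℕ} (hk : k < 10) (d a : ℕ) :
    ∑ b ∈ Finset.range 11, cnt (k + 1) d b * gb b a =
      ∑ b ∈ Finset.range 11, cnt k a b * hh (k + 1) (2 * a - b) d := by
  classical
  rw [← sum_core (by omega) (fun b => gb b a),
    ← sum_core (by omega) (fun b => hh (k + 1) (2 * a - b) d)]
  have h := Finset.sum_card_bipartiteAbove_eq_sum_card_bipartiteBelow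
    (fun W A : Submodule (ZMod 2) VV => hull A ≤ W) (s := subs (k + 1) d) (t := subs k a)
  refine Eq.trans (Finset.sum_congr rfl fun W hW => ?_)
    (h.trans (Finset.sum_congr rfl fun A hA => ?_))
  · have hW' := mem_subs.1 hW
    have h2 := card_filter_between ⊥ (core W) bot_le a
    rw [finrank_bot, hh, if_pos (Nat.zero_le _)] at h2
    simp only [Nat.sub_zero] at h2
    rw [← h2, Finset.bipartiteAbove]
    congr 1
    ext A
    simp only [Finset.mem_filter, Finset.mem_univ, true_and, mem_subs, hull_le_iff, bot_le]
    constructor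
    · rintro ⟨h3, h4⟩
      exact ⟨⟨h3.trans (core_le_Pk hk hW'.1), h4⟩, h3⟩
    · rintro ⟨⟨h3, h4⟩, h5⟩
      exact ⟨h5, h4⟩
  · have hA' := mem_subs.1 hA
    have h3 := finrank_hull (hA'.1.trans (Pk_mono (by omega)))
    have h2 := card_filter_between (hull A) (Pk (k + 1)) (hull_le_Pk hA'.1) d
    rw [finrank_Pk (by omega)] at h2
    have h4 : 2 * a - Module.finrank (ZMod 2) (core A) = Module.finrank (ZMod 2) (hull A) := by
      rw [← hA'.2]; omega
    rw [h4, ← h2, Finset.bipartiteBelow]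
    congr 1
    ext W
    simp only [Finset.mem_filter, Finset.mem_univ, true_and, mem_subs]
    tauto

/-- The inverse matrix of the Gaussian binomial coefficients. -/
def mu (a b : ℕ) : ℤ :=
  if b ≤ a then (-1) ^ (a - b) * 2 ^ ((a - b) * (a - b - 1) / 2) * (gb a b : ℤ) else 0

theorem mu_orth : ∀ m < 11, ∀ b < 11,
    ∑ a ∈ Finset.range 11, mu a b * (gb m a : ℤ) = if m = b then 1 else 0 := by
  decide +kernel

theorem inversion (x S : ℕ → ℤ)
    (h : ∀ a < 11, ∑ m ∈ Finset.range 11, x m * (gb m a : ℤ) = S a) (b : ℕ) (hb : b < 11) :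
    x b = ∑ a ∈ Finset.range 11, mu a b * S a := by
  have h1 : ∑ a ∈ Finset.range 11, mu a b * S a =
      ∑ a ∈ Finset.range 11, ∑ m ∈ Finset.range 11, x m * (mu a b * (gb m a : ℤ)) := by
    refine Finset.sum_congr rfl fun a ha => ?_
    rw [← h a (Finset.mem_range.1 ha), Finset.mul_sum]
    refine Finset.sum_congr rfl fun m _ => ?_
    ring
  rw [h1, Finset.sum_comm]
  have h2 : ∀ m ∈ Finset.range 11,
      ∑ a ∈ Finset.range 11, x m * (mu a b * (gb m a : ℤ)) = if m = b then x m else 0 := by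
    intro m hm
    rw [← Finset.mul_sum, mu_orth m (Finset.mem_range.1 hm) b hb]
    simp
  rw [Finset.sum_congr rfl h2, Finset.sum_ite_eq' , if_pos (Finset.mem_range.2 hb)]

/-- Entry of a table. -/
def entry (T : List (List ℤ)) (d b : ℕ) : ℤ := (T.getD d []).getD b 0

/-- The table `T` lists the numbers `cnt k d b`. -/
def IsTab (k : ℕ) (T : List (List ℤ)) : Prop :=
  ∀ d < 11, ∀ b < 11, (cnt k d b : ℤ) = entry T d b

theorem isTab_step {k : ℕ} (hk : k < 10) {T T' : List (List ℤ)} (hT : IsTab k T)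
    (hT' : ∀ d < 11, ∀ b < 11, entry T' d b = ∑ a ∈ Finset.range 11, mu a b *
      ∑ c ∈ Finset.range 11, entry T a c * (hh (k + 1) (2 * a - c) d : ℤ)) :
    IsTab (k + 1) T' := by
  intro d hd b hb
  rw [hT' d hd b hb]
  refine inversion (fun b => (cnt (k + 1) d b : ℤ)) _ (fun a ha => ?_) b hb
  have h := double_count hk d a
  have h' := congrArg (Nat.cast : ℕ → ℤ) h
  push_cast at h'
  rw [h']
  refine Finset.sum_congr rfl fun c hc => ?_
  rw [hT a ha c (Finset.mem_range.1 hc)]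

theorem isTab_zero : IsTab 0 [[1]] := by
  classical
  have hsub : ∀ d b : ℕ, cnt 0 d b = if d = 0 ∧ b = 0 then 1 else 0 := by
    intro d b
    have hc : core (⊥ : Submodule (ZMod 2) VV) = ⊥ := by rw [core, bot_inf_eq]
    have : ((subs 0 d).filter fun W => Module.finrank (ZMod 2) (core W) = b) =
        if d = 0 ∧ b = 0 then {⊥} else ∅ := by
      ext W
      rw [Finset.mem_filter, mem_subs, Pk_zero, le_bot_iff]
      constructor
      · rintro ⟨⟨rfl, h1⟩, h2⟩
        rw [hc] at h2
        rw [finrank_bot] at h1 h2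
        rw [if_pos ⟨h1.symm, h2.symm⟩]
        simp
      · intro h
        split_ifs at h with h0
        · rw [Finset.mem_singleton] at h
          subst h
          rw [hc, finrank_bot]
          exact ⟨⟨rfl, h0.1.symm⟩, h0.2.symm⟩
        · simp at h
    rw [cnt, this]
    split_ifs <;> simp
  intro d hd b hb
  rw [hsub]
  revert b
  revert d
  decide +kernel

theorem isTab_at1 : IsTab 1
    [[1], [1]] :=
  isTab_step (by norm_num) isTab_zero (by decide +kernel)

theorem isTab_at2 : IsTab 2
    [[1], [3], [0, 1]] :=
  isTab_step (by norm_num) isTab_at1 (by decide +kernel)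

theorem isTab_at3 : IsTab 3
    [[1], [7], [4, 3], [0, 0, 1]] :=
  isTab_step (by norm_num) isTab_at2 (by decide +kernel)

theorem isTab_at4 : IsTab 4
    [[1], [15], [28, 7], [0, 12, 3], [0, 0, 0, 1]] :=
  isTab_step (by norm_num) isTab_at3 (by decide +kernel)

theorem isTab_at5 : IsTab 5
    [[1], [31], [140, 15], [64, 84, 7], [0, 0, 28, 3], [0, 0, 0, 0, 1]] :=
  isTab_step (by norm_num) isTab_at4 (by decide +kernel)

theorem isTab_at6 : IsTab 6
    [[1], [63], [620, 31], [960, 420, 15], [0, 448, 196, 7], [0, 0, 0, 60, 3],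
    [0, 0, 0, 0, 0, 1]] :=
  isTab_step (by norm_num) isTab_at5 (by decide +kernel)

theorem isTab_at7 : IsTab 7
    [[1], [127], [2604, 63], [9920, 1860, 31], [4096, 6720, 980, 15], [0, 0, 2240, 420, 7],
    [0, 0, 0, 0, 124, 3], [0, 0, 0, 0, 0, 0, 1]] :=
  isTab_step (by norm_num) isTab_at6 (by decide +kernel)

theorem isTab_at8 : IsTab 8
    [[1], [255], [10668, 127], [89280, 7812, 63], [126976, 69440, 4340, 31],
    [0, 61440, 33600, 2100, 15], [0, 0, 0, 9920, 868, 7], [0, 0, 0, 0, 0, 252, 3],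
    [0, 0, 0, 0, 0, 0, 0, 1]] :=
  isTab_step (by norm_num) isTab_at7 (by decide +kernel)

theorem isTab_at9 : IsTab 9
    [[1], [511], [43180, 255], [755904, 32004, 127], [2666496, 624960, 18228, 63],
    [1048576, 1904640, 347200, 9300, 31], [0, 0, 634880, 148800, 4340, 15],
    [0, 0, 0, 0, 41664, 1764, 7], [0, 0, 0, 0, 0, 0, 508, 3], [0, 0, 0, 0, 0, 0, 0, 0, 1]] :=
  isTab_step (by norm_num) isTab_at8 (by decide +kernel)

theorem isTab_at10 : IsTab 10
    [[1], [1023], [173740, 511], [6217920, 129540, 255], [48377856, 5291328, 74676, 127],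
    [66060288, 39997440, 3124800, 39060, 63], [0, 32505856, 19681280, 1537600, 19220, 31],
    [0, 0, 0, 5713920, 624960, 8820, 15], [0, 0, 0, 0, 0, 170688, 3556, 7],
    [0, 0, 0, 0, 0, 0, 0, 1020, 3], [0, 0, 0, 0, 0, 0, 0, 0, 0, 1]] :=
  isTab_step (by norm_num) isTab_at9 (by decide +kernel)

/-- The common zero space of a tuple of functionals. -/
def zeros {n : ℕ} (α : Fin n → Fin (10 + 1) → ZMod 2) : Submodule (ZMod 2) VV where
  carrier := {w | ∀ j, α j ⬝ᵥ w = 0}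
  zero_mem' := by intro j; simp
  add_mem' := by
    intro u v hu hv j
    rw [dotProduct_add, hu j, hv j, add_zero]
  smul_mem' := by
    intro c v hv j
    rw [dotProduct_smul, hv j, smul_zero]

theorem mem_zeros {n : ℕ} {α : Fin n → Fin (10 + 1) → ZMod 2} {w : VV} :
    w ∈ zeros α ↔ ∀ j, α j ⬝ᵥ w = 0 := Iff.rfl

theorem dot_ext0 (β : VV) (v : Fin 10 → ZMod 2) :
    β ⬝ᵥ ext0 10 v = ∑ c : Fin 10, β c.castSucc * v c := by
  rw [dotProduct, Fin.sum_univ_castSucc]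
  simp [ext0_apply]

theorem dot_shift_ext0 (β : VV) (v : Fin 10 → ZMod 2) :
    β ⬝ᵥ shift (ext0 10 v) = ∑ c : Fin 10, β c.succ * v c := by
  rw [dotProduct, Fin.sum_univ_succ]
  simp [ext0_apply, shift_zero, shift_succ]

theorem map_ker {n : ℕ} (α : Fin n → Fin (10 + 1) → ZMod 2) :
    (LinearMap.ker (persymMatrix n 10 α).mulVecLin).map (ext0 10) = Pk 10 ⊓ core (zeros α) := by
  have hiff : ∀ v : Fin 10 → ZMod 2, v ∈ LinearMap.ker (persymMatrix n 10 α).mulVecLin ↔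
      ext0 10 v ∈ core (zeros α) := by
    intro v
    rw [LinearMap.mem_ker, Matrix.mulVecLin_apply, core, Submodule.mem_inf, Submodule.mem_comap,
      mem_zeros, mem_zeros]
    constructor
    · intro h
      constructor
      · intro j
        have h1 := congrFun h ⟨2 * j.val, by omega⟩
        rw [Pi.zero_apply] at h1
        refine (dot_ext0 (α j) v).trans ?_
        rw [← h1]
        simp only [Matrix.mulVec, dotProduct, persymMatrix, Matrix.of_apply]
        refine Finset.sum_congr rfl fun c _ => ?_
        congr 2
        · congr 1
          apply Fin.ext
          simp
        · apply Fin.ext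
          simp
      · intro j
        have h1 := congrFun h ⟨2 * j.val + 1, by omega⟩
        rw [Pi.zero_apply] at h1
        refine (dot_shift_ext0 (α j) v).trans ?_
        rw [← h1]
        simp only [Matrix.mulVec, dotProduct, persymMatrix, Matrix.of_apply]
        refine Finset.sum_congr rfl fun c _ => ?_
        congr 2
        · congr 1
          apply Fin.ext
          simp
          omega
        · apply Fin.ext
          simp
          omega
    · rintro ⟨h0, h1⟩
      funext r
      rw [Pi.zero_apply]
      have hr := r.2
      rcases Nat.mod_two_eq_zero_or_one r.val with hm | hm
      · refine Eq.trans ?_ ((dot_ext0 (α ⟨r.val / 2, by omega⟩) v).symm.trans (h0 _))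
        simp only [Matrix.mulVec, dotProduct, persymMatrix, Matrix.of_apply]
        refine Finset.sum_congr rfl fun c _ => ?_
        congr 2
        apply Fin.ext
        simp [hm]
      · refine Eq.trans ?_ ((dot_shift_ext0 (α ⟨r.val / 2, by omega⟩) v).symm.trans (h1 _))
        simp only [Matrix.mulVec, dotProduct, persymMatrix, Matrix.of_apply]
        refine Finset.sum_congr rfl fun c _ => ?_
        congr 2
        apply Fin.ext
        simp [hm]
        omega
  ext w
  rw [Submodule.mem_map, Submodule.mem_inf, ← ext0_range (by norm_num), LinearMap.mem_range]
  constructor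
  · rintro ⟨v, hv, rfl⟩
    exact ⟨⟨v, rfl⟩, (hiff v).1 hv⟩
  · rintro ⟨⟨v, rfl⟩, hv⟩
    exact ⟨v, (hiff v).2 hv, rfl⟩

theorem rank_add {n : ℕ} (α : Fin n → Fin (10 + 1) → ZMod 2) :
    (persymMatrix n 10 α).rank +
      Module.finrank (ZMod 2) (Pk 10 ⊓ core (zeros α) : Submodule (ZMod 2) VV) = 10 := by
  have h := LinearMap.finrank_range_add_finrank_ker (persymMatrix n 10 α).mulVecLin
  rw [← map_ker, ← LinearEquiv.finrank_eq (Submodule.equivMapOfInjective (ext0 10)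
    (ext0_inj (by norm_num)) (LinearMap.ker (persymMatrix n 10 α).mulVecLin))]
  rw [Matrix.rank, h]
  simp

/-- The functionals vanishing on a given subspace. -/
def perp (E : Submodule (ZMod 2) VV) : Submodule (ZMod 2) VV :=
  LinearMap.BilinForm.orthogonal (dotProductBilin (ZMod 2) (ZMod 2)) E

theorem mem_perp {E : Submodule (ZMod 2) VV} {β : VV} : β ∈ perp E ↔ ∀ w ∈ E, β ⬝ᵥ w = 0 := by
  rw [perp, LinearMap.BilinForm.mem_orthogonal_iff]
  refine forall₂_congr fun w _ => ?_
  rw [dotProduct_comm]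
  rfl

theorem finrank_perp (E : Submodule (ZMod 2) VV) :
    Module.finrank (ZMod 2) (perp E) = 11 - Module.finrank (ZMod 2) E := by
  rw [perp, LinearMap.BilinForm.finrank_orthogonal]
  · simp
  · constructor
    · intro v hv
      exact dotProduct_eq_zero v hv
    · intro v hv
      exact dotProduct_eq_zero v fun w => by rw [dotProduct_comm]; exact hv w

open scoped Classical in
theorem card_tuples (n : ℕ) (E : Submodule (ZMod 2) VV) :
    (Finset.univ.filter fun α : Fin n → Fin (10 + 1) → ZMod 2 => E ≤ zeros α).card =
      (2 ^ (11 - Module.finrank (ZMod 2) E)) ^ n := by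
  have h1 : Fintype.card (perp E) = 2 ^ (11 - Module.finrank (ZMod 2) E) := by
    rw [Module.card_eq_pow_finrank (K := ZMod 2), finrank_perp, ZMod.card]
  rw [← h1, ← Fintype.card_subtype]
  have e : {α : Fin n → Fin (10 + 1) → ZMod 2 // E ≤ zeros α} ≃ (Fin n → perp E) :=
    { toFun := fun α j => ⟨α.1 j, mem_perp.2 fun w hw => α.2 hw j⟩
      invFun := fun β => ⟨fun j => (β j).1, fun w hw j => mem_perp.1 (β j).2 w hw⟩
      left_inv := fun α => rfl
      right_inv := fun β => rfl }
  rw [Fintype.card_congr e]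
  simp

/-- The number of tuples whose kernel has dimension `m`. -/
noncomputable def kerCount (n m : ℕ) : ℕ :=
  (Finset.univ.filter fun α : Fin n → Fin (10 + 1) → ZMod 2 =>
    Module.finrank (ZMod 2) (Pk 10 ⊓ core (zeros α) : Submodule (ZMod 2) VV) = m).card

theorem gamma_eq_kerCount (n : ℕ) : Gamma n 10 8 = kerCount n 2 := by
  classical
  rw [Gamma, kerCount, Nat.card_eq_fintype_card, Fintype.card_subtype]
  congr 1
  ext α
  simp only [Finset.mem_filter, Finset.mem_univ, true_and]
  have := rank_add α
  omega

theorem double_count_final (n a : ℕ) :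
    ∑ m ∈ Finset.range 11, kerCount n m * gb m a =
      ∑ b ∈ Finset.range 11, cnt 10 a b * (2 ^ (11 - (2 * a - b))) ^ n := by
  classical
  have hm : ∀ α ∈ (Finset.univ : Finset (Fin n → Fin (10 + 1) → ZMod 2)),
      Module.finrank (ZMod 2) (Pk 10 ⊓ core (zeros α) : Submodule (ZMod 2) VV)
        ∈ Finset.range 11 := by
    intro α _
    have := rank_add α
    rw [Finset.mem_range]
    omega
  have hL : ∑ m ∈ Finset.range 11, kerCount n m * gb m a =
      ∑ α : Fin n → Fin (10 + 1) → ZMod 2,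
        gb (Module.finrank (ZMod 2) (Pk 10 ⊓ core (zeros α) : Submodule (ZMod 2) VV)) a := by
    rw [← Finset.sum_fiberwise_of_maps_to hm]
    refine Finset.sum_congr rfl fun b _ => ?_
    rw [kerCount, ← smul_eq_mul, ← Finset.sum_const]
    refine Finset.sum_congr (by congr) fun W hW => ?_
    rw [(Finset.mem_filter.1 hW).2]
  rw [hL, ← sum_core le_rfl (fun b => (2 ^ (11 - (2 * a - b))) ^ n)]
  have h := Finset.sum_card_bipartiteAbove_eq_sum_card_bipartiteBelow
    (fun (α : Fin n → Fin (10 + 1) → ZMod 2) (A : Submodule (ZMod 2) VV) => hull A ≤ zeros α)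
    (s := Finset.univ) (t := subs 10 a)
  refine Eq.trans (Finset.sum_congr rfl fun α _ => ?_)
    (h.trans (Finset.sum_congr rfl fun A hA => ?_))
  · have h2 := card_filter_between ⊥ (Pk 10 ⊓ core (zeros α)) bot_le a
    rw [finrank_bot, hh, if_pos (Nat.zero_le _)] at h2
    simp only [Nat.sub_zero] at h2
    rw [← h2, Finset.bipartiteAbove]
    congr 1
    ext A
    simp only [Finset.mem_filter, Finset.mem_univ, true_and, mem_subs, hull_le_iff, bot_le,
      le_inf_iff]
    tauto
  · have hA' := mem_subs.1 hA
    have h3 := finrank_hull hA'.1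
    have h4 : 2 * a - Module.finrank (ZMod 2) (core A) = Module.finrank (ZMod 2) (hull A) := by
      rw [← hA'.2]; omega
    rw [h4, ← card_tuples, Finset.bipartiteBelow]

theorem gamma_eight_k_ten (n : ℕ) (hn : 5 ≤ n) :
    (Gamma n 10 8 : ℤ) =
      511 * 2 ^ (8 * n) + 171955 * 2 ^ (7 * n) - 897890 * 2 ^ (6 * n)
        - 38376240 * 2 ^ (5 * n) + 323250144 * 2 ^ (4 * n) + 271514880 * 2 ^ (3 * n)
        - 436135 * 2 ^ 14 * 2 ^ (2 * n) + 242795 * 2 ^ 16 * 2 ^ n - 4445 * 2 ^ 21 := by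
  rw [gamma_eq_kerCount]
  have hinv := inversion (fun m => (kerCount n m : ℤ))
    (fun a => ∑ b ∈ Finset.range 11, (cnt 10 a b : ℤ) * (2 ^ (11 - (2 * a - b))) ^ n)
    (fun a _ => by exact_mod_cast double_count_final n a) 2 (by norm_num)
  rw [hinv]
  have hsum : ∀ a ∈ Finset.range 11,
      mu a 2 * ∑ b ∈ Finset.range 11, (cnt 10 a b : ℤ) * (2 ^ (11 - (2 * a - b))) ^ n =
      mu a 2 * ∑ b ∈ Finset.range 11, entry
        [[1], [1023], [173740, 511], [6217920, 129540, 255], [48377856, 5291328, 74676, 127],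
        [66060288, 39997440, 3124800, 39060, 63], [0, 32505856, 19681280, 1537600, 19220, 31],
        [0, 0, 0, 5713920, 624960, 8820, 15], [0, 0, 0, 0, 0, 170688, 3556, 7],
        [0, 0, 0, 0, 0, 0, 0, 1020, 3], [0, 0, 0, 0, 0, 0, 0, 0, 0, 1]] a b *
          (2 ^ n) ^ (11 - (2 * a - b)) := by
    intro a ha
    congr 1
    refine Finset.sum_congr rfl fun b hb => ?_
    rw [isTab_at10 a (Finset.mem_range.1 ha) b (Finset.mem_range.1 hb), ← pow_mul, ← pow_mul,
      mul_comm n]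
  rw [Finset.sum_congr rfl hsum]
  have m0 : mu 0 2 = 0 := by decide +kernel
  have m1 : mu 1 2 = 0 := by decide +kernel
  have m2 : mu 2 2 = 1 := by decide +kernel
  have m3 : mu 3 2 = -7 := by decide +kernel
  have m4 : mu 4 2 = 70 := by decide +kernel
  have m5 : mu 5 2 = -1240 := by decide +kernel
  have m6 : mu 6 2 = 41664 := by decide +kernel
  have m7 : mu 7 2 = -2731008 := by decide +kernel
  have m8 : mu 8 2 = 353730560 := by decide +kernel
  have m9 : mu 9 2 = -91089797120 := by decide +kernel
  have m10 : mu 10 2 = 46775146643456 := by decide +kernel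
  have hp : ∀ c : ℕ, (2 : ℤ) ^ (c * n) = (2 ^ n) ^ c := fun c => by
    rw [← pow_mul, mul_comm]
  simp only [hp, Finset.sum_range_succ, Finset.sum_range_zero, m0, m1, m2, m3, m4, m5, m6, m7,
    m8, m9, m10, entry, List.getD_cons_zero, List.getD_cons_succ, List.getD_nil]
  generalize (2 : ℤ) ^ n = y
  norm_num
  ring
end

section
/- For k = 10 and every integer n ≥ 5, the number of parameter tuples whose associated n-times persymmetric 2n×10 matrix over 𝔽₂ has rank 9 is Γ_9(n,10) = 1023·2^{9n} − 1533·2^{8n} − 517650·2^{7n} + 1798320·2^{6n} + 78214752·2^{5n} − 559464192·2^{4n} − 783237120·2^{3n} + 200235·2^{16}·2^{2n} − 106680·2^{18}·2^n + 480·2^{25} (an identity of integers). -/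
open Finset

/-- Number of injective linear maps from an `v`-dimensional to an `r`-dimensional space. -/
def injC (r : ℕ) : ℕ → ℕ
  | 0 => 1
  | v + 1 => injC r v * (2 ^ r - 2 ^ v)

/-- Gaussian binomial coefficient for `q = 2`. -/
def gs (r v : ℕ) : ℕ := injC r v / injC v v

/-- Number of `w`-dimensional spaces between a `u`-dimensional and a `p`-dimensional one. -/
def gsI (p u w : ℕ) : ℕ := if u ≤ w then gs (p - u) (w - u) else 0

/-- Coefficients of the inverse of the matrix of Gaussian binomials. -/
def ginv (j v : ℕ) : ℤ :=
  if j ≤ v then (-1) ^ (v - j) * 2 ^ ((v - j) * (v - j - 1) / 2) * (gs v j : ℤ) else 0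

def sumTo (f : ℕ → ℤ) : ℕ → ℤ
  | 0 => 0
  | n + 1 => sumTo f n + f n

lemma sumTo_eq (f : ℕ → ℤ) (n : ℕ) : sumTo f n = ∑ i ∈ Finset.range n, f i := by
  induction n with
  | zero => rfl
  | succ n ih => rw [Finset.sum_range_succ, ← ih]; rfl

lemma ginv_dec : ∀ r < 11, ∀ j < 11, sumTo (fun v => ginv j v * (gs r v : ℤ)) 11 = if r = j then 1 else 0 := by
  decide +kernel

lemma ginv_spec (r j : ℕ) (hr : r < 11) (hj : j < 11) :
    ∑ v ∈ Finset.range 11, ginv j v * (gs r v : ℤ) = if r = j then 1 else 0 := by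
  rw [← sumTo_eq]; exact ginv_dec r hr j hj

def tab : ℕ → List (List ℤ)
  | 0 => [[1]]
  | 1 => [[1], [1]]
  | 2 => [[1], [3], [0, 1]]
  | 3 => [[1], [7], [4, 3], [0, 0, 1]]
  | 4 => [[1], [15], [28, 7], [0, 12, 3], [0, 0, 0, 1]]
  | 5 => [[1], [31], [140, 15], [64, 84, 7], [0, 0, 28, 3], [0, 0, 0, 0, 1]]
  | 6 => [[1], [63], [620, 31], [960, 420, 15], [0, 448, 196, 7], [0, 0, 0, 60, 3], [0, 0, 0, 0, 0, 1]]
  | 7 => [[1], [127], [2604, 63], [9920, 1860, 31], [4096, 6720, 980, 15], [0, 0, 2240, 420, 7], [0, 0, 0, 0, 124, 3], [0, 0, 0, 0, 0, 0, 1]]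
  | 8 => [[1], [255], [10668, 127], [89280, 7812, 63], [126976, 69440, 4340, 31], [0, 61440, 33600, 2100, 15], [0, 0, 0, 9920, 868, 7], [0, 0, 0, 0, 0, 252, 3], [0, 0, 0, 0, 0, 0, 0, 1]]
  | 9 => [[1], [511], [43180, 255], [755904, 32004, 127], [2666496, 624960, 18228, 63], [1048576, 1904640, 347200, 9300, 31], [0, 0, 634880, 148800, 4340, 15], [0, 0, 0, 0, 41664, 1764, 7], [0, 0, 0, 0, 0, 0, 508, 3], [0, 0, 0, 0, 0, 0, 0, 0, 1]]
  | 10 => [[1], [1023], [173740, 511], [6217920, 129540, 255], [48377856, 5291328, 74676, 127], [66060288, 39997440, 3124800, 39060, 63], [0, 32505856, 19681280, 1537600, 19220, 31], [0, 0, 0, 5713920, 624960, 8820, 15], [0, 0, 0, 0, 0, 170688, 3556, 7], [0, 0, 0, 0, 0, 0, 0, 1020, 3], [0, 0, 0, 0, 0, 0, 0, 0, 0, 1]]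
  | _ => []

def look (k w j : ℕ) : ℤ := ((tab k).getD w []).getD j 0

def innerS (k v w : ℕ) : ℤ := sumTo (fun i => look k v i * (gsI (k + 1) (2 * v - i) w : ℤ)) 11

def stepB (k w j : ℕ) : Bool :=
  sumTo (fun v => ginv j v * innerS k v w) 11 == look (k + 1) w j

lemma step_dec : ∀ k < 10, ∀ w < 11, ∀ j < 11, stepB k w j = true := by
  decide +kernel

lemma step_spec (k w j : ℕ) (hk : k < 10) (hw : w < 11) (hj : j < 11) :
    ∑ v ∈ Finset.range 11, ginv j v * ∑ i ∈ Finset.range 11,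
      look k v i * (gsI (k + 1) (2 * v - i) w : ℤ) = look (k + 1) w j := by
  have h := step_dec k hk w hw j hj
  simp only [stepB, beq_iff_eq, sumTo_eq, innerS] at h
  exact h

lemma injC_eq (r v : ℕ) : injC r v = ∏ i : Fin v, (2 ^ r - 2 ^ i.val) := by
  induction v with
  | zero => rfl
  | succ v ih => rw [Fin.prod_univ_castSucc, injC, ih]; simp

lemma injC_pos (v : ℕ) : 0 < injC v v := by
  rw [injC_eq]
  apply Finset.prod_pos
  intro i _
  have : 2 ^ i.val < 2 ^ v := Nat.pow_lt_pow_right (by norm_num) i.isLt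
  omega

lemma injC_zero (r v : ℕ) (h : r < v) : injC r v = 0 := by
  rw [injC_eq]
  exact Finset.prod_eq_zero (Finset.mem_univ (⟨r, h⟩ : Fin v)) (by simp)

lemma card_li {V : Type*} [AddCommGroup V] [Module (ZMod 2) V] [Finite V] (v : ℕ)
    (hv : v ≤ Module.finrank (ZMod 2) V) :
    Nat.card {s : Fin v → V // LinearIndependent (ZMod 2) s} =
      injC (Module.finrank (ZMod 2) V) v := by
  rw [card_linearIndependent hv, injC_eq]
  simp

lemma span_of_li {V : Type*} [AddCommGroup V] [Module (ZMod 2) V] [Finite V] {v : ℕ}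
    (W : Submodule (ZMod 2) V) (hW : Module.finrank (ZMod 2) W = v) (s : Fin v → W)
    (hs : LinearIndependent (ZMod 2) s) :
    Submodule.span (ZMod 2) (Set.range (fun i => (s i : V))) = W := by
  have hs' : LinearIndependent (ZMod 2) (fun i => (s i : V)) :=
    hs.map' (Submodule.subtype _) (Submodule.ker_subtype _)
  apply Submodule.eq_of_le_of_finrank_eq
  · rw [Submodule.span_le]; rintro _ ⟨i, rfl⟩; exact (s i).2
  · rw [finrank_span_eq_card hs', hW]
    simp

/-- A subspace with a basis of it gives a linearly independent family. -/
def liFun (V : Type*) [AddCommGroup V] [Module (ZMod 2) V] (v : ℕ) 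
    (p : (W : {W : Submodule (ZMod 2) V // Module.finrank (ZMod 2) W = v}) ×
        {s : Fin v → W.1 // LinearIndependent (ZMod 2) s}) :
    {s : Fin v → V // LinearIndependent (ZMod 2) s} :=
  ⟨fun i => (p.2.1 i : V), p.2.2.map' (Submodule.subtype _) (Submodule.ker_subtype _)⟩

lemma liFun_bij (V : Type*) [AddCommGroup V] [Module (ZMod 2) V] [Finite V] (v : ℕ) :
    Function.Bijective (liFun V v) := by
  constructor
  · rintro ⟨⟨W, hW⟩, ⟨s, hs⟩⟩ ⟨⟨W', hW'⟩, ⟨s', hs'⟩⟩ h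
    have h1 : (fun i => (s i : V)) = (fun i => (s' i : V)) := congrArg Subtype.val h
    have h2 : W = W' := by
      rw [← span_of_li W hW s hs, ← span_of_li W' hW' s' hs', h1]
    subst h2
    have h3 : s = s' := by
      funext i
      exact Subtype.ext (congrFun h1 i)
    subst h3
    rfl
  · intro s
    refine ⟨⟨⟨Submodule.span (ZMod 2) (Set.range s.1), by
      rw [finrank_span_eq_card s.2]; simp⟩,
    ⟨fun i => ⟨s.1 i, Submodule.subset_span ⟨i, rfl⟩⟩, ?_⟩⟩, rfl⟩
    apply LinearIndependent.of_comp (Submodule.subtype _)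
    exact s.2

lemma card_sub (V : Type*) [AddCommGroup V] [Module (ZMod 2) V] [Finite V] (v : ℕ) :
    Nat.card {W : Submodule (ZMod 2) V // Module.finrank (ZMod 2) W = v} =
      gs (Module.finrank (ZMod 2) V) v := by
  unfold gs
  by_cases hv : v ≤ Module.finrank (ZMod 2) V
  · symm
    apply Nat.div_eq_of_eq_mul_left (injC_pos v)
    have : Finite (Submodule (ZMod 2) V) := inferInstance
    have := Fintype.ofFinite {W : Submodule (ZMod 2) V // Module.finrank (ZMod 2) W = v}
    rw [← card_li v hv, ← Nat.card_congr (Equiv.ofBijective _ (liFun_bij V v)), Nat.card_sigma]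
    have : ∀ W : {W : Submodule (ZMod 2) V // Module.finrank (ZMod 2) W = v},
        Nat.card {s : Fin v → W.1 // LinearIndependent (ZMod 2) s} = injC v v := by
      intro W
      rw [card_li v W.2.ge, W.2]
    simp [this]
  · rw [injC_zero _ _ (by omega), Nat.zero_div]
    rw [Nat.card_eq_zero]
    left
    constructor
    rintro ⟨W, hW⟩
    exact hv (hW ▸ Submodule.finrank_le W)

/-- Subspaces between `U` and `P` are subspaces of `P / U`. -/
def icEquiv {E : Type*} [AddCommGroup E] [Module (ZMod 2) E] (U P : Submodule (ZMod 2) E)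
    (hUP : U ≤ P) :
    Submodule (ZMod 2) (P ⧸ (U.submoduleOf P)) ≃ {W : Submodule (ZMod 2) E // U ≤ W ∧ W ≤ P} where
  toFun Y := ⟨(Y.comap (Submodule.mkQ _)).map P.subtype, by
    constructor
    · intro x hx
      refine ⟨⟨x, hUP hx⟩, ?_, rfl⟩
      have : Submodule.mkQ (U.submoduleOf P) ⟨x, hUP hx⟩ = 0 := by
        rw [Submodule.mkQ_apply, Submodule.Quotient.mk_eq_zero]
        exact hx
      simp only [Submodule.comap_coe, Set.mem_preimage, this]
      exact Y.zero_mem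
    · exact Submodule.map_subtype_le _ _⟩
  invFun W := (W.1.comap P.subtype).map (Submodule.mkQ _)
  left_inv Y := by
    simp only
    rw [Submodule.comap_map_eq_of_injective P.injective_subtype,
      Submodule.map_comap_eq_of_surjective (Submodule.mkQ_surjective _)]
  right_inv W := by
    apply Subtype.ext
    simp only
    rw [Submodule.comap_map_eq, Submodule.ker_mkQ, sup_eq_left.2, Submodule.map_comap_subtype,
      inf_eq_right.2 W.2.2]
    exact Submodule.comap_mono W.2.1

lemma card_ic {E : Type*} [AddCommGroup E] [Module (ZMod 2) E] (U P : Submodule (ZMod 2) E)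
    [Finite P] (hUP : U ≤ P) (w : ℕ) :
    Nat.card {W : Submodule (ZMod 2) E // (U ≤ W ∧ W ≤ P) ∧ Module.finrank (ZMod 2) W = w} =
      gsI (Module.finrank (ZMod 2) P) (Module.finrank (ZMod 2) U) w := by
  have hUf : Module.finrank (ZMod 2) (U.submoduleOf P) = Module.finrank (ZMod 2) U :=
    (Submodule.submoduleOfEquivOfLe hUP).finrank_eq
  have hq : Module.finrank (ZMod 2) (P ⧸ (U.submoduleOf P)) =
      Module.finrank (ZMod 2) P - Module.finrank (ZMod 2) U := by
    have := Submodule.finrank_quotient_add_finrank (U.submoduleOf P)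
    omega
  have hdim : ∀ Y : Submodule (ZMod 2) (P ⧸ (U.submoduleOf P)),
      Module.finrank (ZMod 2) ((icEquiv U P hUP Y).1) =
        Module.finrank (ZMod 2) Y + Module.finrank (ZMod 2) U := by
    intro Y
    have h0 : Module.finrank (ZMod 2) ((icEquiv U P hUP Y).1) =
        Module.finrank (ZMod 2) (Y.comap (Submodule.mkQ (U.submoduleOf P))) :=
      Submodule.finrank_map_subtype_eq P (Y.comap (Submodule.mkQ (U.submoduleOf P)))
    rw [h0]
    have h1 := LinearMap.finrank_range_add_finrank_ker
      ((Submodule.mkQ (U.submoduleOf P)).domRestrict (Y.comap (Submodule.mkQ (U.submoduleOf P))))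
    have h2 : LinearMap.range ((Submodule.mkQ (U.submoduleOf P)).domRestrict
        (Y.comap (Submodule.mkQ (U.submoduleOf P)))) = Y := by
      rw [LinearMap.range_domRestrict,
        Submodule.map_comap_eq_of_surjective (Submodule.mkQ_surjective _)]
    have h3 : Module.finrank (ZMod 2) (LinearMap.ker ((Submodule.mkQ (U.submoduleOf P)).domRestrict
        (Y.comap (Submodule.mkQ (U.submoduleOf P))))) = Module.finrank (ZMod 2) U := by
      rw [LinearMap.ker_domRestrict, Submodule.ker_mkQ, ← hUf]
      apply LinearEquiv.finrank_eq
      apply Submodule.submoduleOfEquivOfLe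
      intro x hx
      have : Submodule.mkQ (U.submoduleOf P) x = 0 := by
        rw [Submodule.mkQ_apply, Submodule.Quotient.mk_eq_zero]
        exact hx
      rw [Submodule.mem_comap, this]
      exact Y.zero_mem
    rw [h2, h3] at h1
    exact h1.symm
  have hfin : Finite (P ⧸ (U.submoduleOf P)) :=
    Finite.of_surjective _ (Submodule.mkQ_surjective (U.submoduleOf P))
  unfold gsI
  split_ifs with h
  · rw [← hq, ← card_sub]
    symm
    apply Nat.card_congr
    refine Equiv.trans ((icEquiv U P hUP).subtypeEquiv (q := fun W => Module.finrank (ZMod 2) W.1 = w) ?_)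
      (Equiv.subtypeSubtypeEquivSubtypeInter _ (fun W : Submodule (ZMod 2) E => Module.finrank (ZMod 2) W = w))
    intro Y
    rw [hdim]
    omega
  · rw [Nat.card_eq_zero]
    left
    constructor
    rintro ⟨W, ⟨hU, hW⟩, hw⟩
    have : Finite W := Finite.of_injective _ (Submodule.inclusion_injective hW)
    have := Submodule.finrank_mono hU
    omega

abbrev PS := Submodule (ZMod 2) (Polynomial (ZMod 2))

/-- Polynomials of degree less than `k`. -/
noncomputable abbrev PD (k : ℕ) : PS := Polynomial.degreeLT (ZMod 2) k

/-- Multiplication by `X`. -/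
noncomputable def shiftX : Polynomial (ZMod 2) →ₗ[ZMod 2] Polynomial (ZMod 2) :=
  LinearMap.mulLeft (ZMod 2) Polynomial.X

lemma shiftX_apply (p : Polynomial (ZMod 2)) : shiftX p = Polynomial.X * p := rfl

lemma shiftX_inj : Function.Injective shiftX := by
  intro p q h
  exact mul_left_cancel₀ Polynomial.X_ne_zero h

noncomputable def der (W : PS) : PS := W ⊓ W.comap shiftX

noncomputable def fr (W : PS) : ℕ := Module.finrank (ZMod 2) W

noncomputable def dd (W : PS) : ℕ := fr (der W)

abbrev SS (k : ℕ) := {W : PS // W ≤ PD k}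

instance finPD (k : ℕ) : Finite (PD k) :=
  Finite.of_injective _ (Polynomial.degreeLTEquiv (ZMod 2) k).injective

lemma fr_PD (k : ℕ) : Module.finrank (ZMod 2) (PD k) = k := by
  rw [(Polynomial.degreeLTEquiv (ZMod 2) k).finrank_eq]; simp

lemma fin_of_le {k : ℕ} {W : PS} (h : W ≤ PD k) : Finite W :=
  Finite.of_injective _ (Submodule.inclusion_injective h)

instance finSS (k : ℕ) : Finite (SS k) := by
  apply Finite.of_injective (fun W : SS k => W.1.submoduleOf (PD k))
  intro W W' h
  apply Subtype.ext
  have h' := congrArg (Submodule.map (PD k).subtype) h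
  simpa [Submodule.submoduleOf, Submodule.map_comap_subtype, inf_eq_right.2 W.2,
    inf_eq_right.2 W'.2] using h'

noncomputable instance ftSS (k : ℕ) : Fintype (SS k) := Fintype.ofFinite _

lemma shiftX_mem {k : ℕ} {p : Polynomial (ZMod 2)} : shiftX p ∈ PD (k + 1) ↔ p ∈ PD k := by
  rw [shiftX_apply, Polynomial.mem_degreeLT, Polynomial.mem_degreeLT]
  by_cases hp : p = 0
  · subst hp; simp
  · rw [Polynomial.degree_mul, Polynomial.degree_X, Polynomial.degree_eq_natDegree hp]
    norm_cast
    omega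

noncomputable def extS (V : PS) : PS := V ⊔ V.map shiftX

lemma ext_le_iff (V W : PS) : extS V ≤ W ↔ V ≤ der W := by
  rw [extS, der, sup_le_iff, le_inf_iff, Submodule.map_le_iff_le_comap]

lemma PD_mono {k : ℕ} : PD k ≤ PD (k + 1) := Polynomial.degreeLT_mono (by omega)

lemma ext_le_PD {k : ℕ} {V : PS} (h : V ≤ PD k) : extS V ≤ PD (k + 1) := by
  rw [ext_le_iff, der, le_inf_iff]
  exact ⟨h.trans PD_mono, fun p hp => shiftX_mem.2 (h hp)⟩

lemma der_le_PD {k : ℕ} {W : PS} (h : W ≤ PD (k + 1)) : der W ≤ PD k := by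
  intro p hp
  exact shiftX_mem.1 (h hp.2)

lemma fr_ext {k : ℕ} {V : PS} (h : V ≤ PD k) : fr (extS V) + dd V = 2 * fr V := by
  have := fin_of_le h
  have h1 := Submodule.finrank_sup_add_finrank_inf_eq V (V.map shiftX)
  have h2 : V ⊓ V.map shiftX = (der V).map shiftX := by
    ext p
    constructor
    · rintro ⟨hp, q, hq, rfl⟩
      exact ⟨q, ⟨hq, hp⟩, rfl⟩
    · rintro ⟨q, ⟨hq, hq'⟩, rfl⟩
      exact ⟨hq', q, hq, rfl⟩
  have h3 : ∀ U : PS, Module.finrank (ZMod 2) (U.map shiftX) = Module.finrank (ZMod 2) U := fun U =>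
    (Submodule.equivMapOfInjective shiftX shiftX_inj U).finrank_eq.symm
  rw [h2, h3, h3] at h1
  unfold dd fr extS
  omega

lemma dd_le {k : ℕ} {V : PS} (h : V ≤ PD k) : dd V ≤ fr V := by
  have := fin_of_le h
  exact Submodule.finrank_mono inf_le_left

lemma fr_le {k : ℕ} {V : PS} (h : V ≤ PD k) : fr V ≤ k := by
  have := Submodule.finrank_mono h
  rwa [fr_PD] at this

open Classical in
lemma count_der {k : ℕ} (W : SS (k + 1)) (v : ℕ) :
    (Finset.univ.filter fun V : SS k => fr V.1 = v ∧ extS V.1 ≤ W.1).card = gs (dd W.1) v := by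
  have := fin_of_le (der_le_PD W.2)
  have h := card_ic ⊥ (der W.1) bot_le v
  rw [finrank_bot] at h
  simp only [gsI, Nat.zero_le, if_true, Nat.sub_zero] at h
  rw [dd, fr, ← h, ← Fintype.card_subtype, ← Nat.card_eq_fintype_card]
  apply Nat.card_congr
  exact
    { toFun := fun V => ⟨V.1.1, ⟨bot_le, (ext_le_iff _ _).1 V.2.2⟩, V.2.1⟩
      invFun := fun V => ⟨⟨V.1, V.2.1.2.trans (der_le_PD W.2)⟩, V.2.2, (ext_le_iff _ _).2 V.2.1.2⟩
      left_inv := fun V => rfl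
      right_inv := fun V => rfl }

open Classical in
lemma count_ext {k : ℕ} (V : SS k) (w : ℕ) :
    (Finset.univ.filter fun W : SS (k + 1) => fr W.1 = w ∧ extS V.1 ≤ W.1).card =
      gsI (k + 1) (2 * fr V.1 - dd V.1) w := by
  have h := card_ic (extS V.1) (PD (k + 1)) (ext_le_PD V.2) w
  have h2 := fr_ext V.2
  rw [fr_PD, show Module.finrank (ZMod 2) (extS V.1) = 2 * fr V.1 - dd V.1 from by
    change fr (extS V.1) = _; omega] at h
  rw [← h, ← Fintype.card_subtype, ← Nat.card_eq_fintype_card]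
  apply Nat.card_congr
  exact
    { toFun := fun W => ⟨W.1.1, ⟨W.2.2, W.1.2⟩, W.2.1⟩
      invFun := fun W => ⟨⟨W.1, W.2.1.2⟩, W.2.2, W.2.1.1⟩
      left_inv := fun V => rfl
      right_inv := fun V => rfl }

open Classical in
lemma double_count_s13 (k v w : ℕ) :
    ∑ W : SS (k + 1), (if fr W.1 = w then gs (dd W.1) v else 0) =
      ∑ V : SS k, if fr V.1 = v then gsI (k + 1) (2 * v - dd V.1) w else 0 := by
  have h1 : ∀ W : SS (k + 1), (if fr W.1 = w then gs (dd W.1) v else 0) =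
      ∑ V : SS k, if fr W.1 = w ∧ fr V.1 = v ∧ extS V.1 ≤ W.1 then 1 else 0 := by
    intro W
    by_cases h : fr W.1 = w
    · rw [if_pos h, ← count_der, Finset.card_filter]
      simp [h]
    · simp [h]
  have h2 : ∀ V : SS k, (if fr V.1 = v then gsI (k + 1) (2 * v - dd V.1) w else 0) =
      ∑ W : SS (k + 1), if fr W.1 = w ∧ fr V.1 = v ∧ extS V.1 ≤ W.1 then 1 else 0 := by
    intro V
    by_cases h : fr V.1 = v
    · rw [if_pos h]
      subst h
      rw [← count_ext, Finset.card_filter]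
      simp
    · simp [h]
  simp only [h1, h2]
  exact Finset.sum_comm

open Classical in
/-- Number of `W` of dimension `w` whose derived space has dimension `j`. -/
noncomputable def MM (k w j : ℕ) : ℤ :=
  ∑ W : SS k, if fr W.1 = w ∧ dd W.1 = j then 1 else 0

open Classical in
lemma sum_group {k : ℕ} (hk : k < 11) (w : ℕ) (f : ℕ → ℤ) :
    ∑ W : SS k, (if fr W.1 = w then f (dd W.1) else 0) =
      ∑ j ∈ Finset.range 11, MM k w j * f j := by
  simp only [MM, Finset.sum_mul]
  rw [Finset.sum_comm]
  apply Finset.sum_congr rfl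
  intro W _
  by_cases h : fr W.1 = w
  · have h1 := dd_le W.2
    have h2 := fr_le W.2
    have : dd W.1 < 11 := by omega
    simp [h, this]
  · simp [h]

lemma MM_succ (k w j : ℕ) (hk : k < 10) (hj : j < 11) :
    MM (k + 1) w j = ∑ v ∈ Finset.range 11, ginv j v * ∑ i ∈ Finset.range 11,
      MM k v i * (gsI (k + 1) (2 * v - i) w : ℤ) := by
  classical
  have h1 : ∀ v, ∑ i ∈ Finset.range 11, MM k v i * (gsI (k + 1) (2 * v - i) w : ℤ) =
      ∑ W : SS (k + 1), if fr W.1 = w then (gs (dd W.1) v : ℤ) else 0 := by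
    intro v
    rw [← sum_group (by omega) v (fun i => (gsI (k + 1) (2 * v - i) w : ℤ))]
    exact_mod_cast (double_count_s13 k v w).symm
  simp only [h1, Finset.mul_sum]
  rw [Finset.sum_comm, MM]
  apply Finset.sum_congr rfl
  intro W _
  by_cases h : fr W.1 = w
  · have h1 := dd_le W.2
    have h2 := fr_le W.2
    simp only [h, if_true, true_and]
    rw [ginv_spec _ _ (by omega) hj]
  · simp [h]

lemma MM_eq (k : ℕ) (hk : k ≤ 10) : ∀ w < 11, ∀ j < 11, MM k w j = look k w j := by
  induction k with
  | zero =>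
    intro w hw j hj
    have h0 : ∀ W : SS 0, fr W.1 = 0 ∧ dd W.1 = 0 := by
      intro W
      have h1 := dd_le W.2
      have h2 := fr_le W.2
      omega
    have hbot : ∀ W : SS 0, W = ⟨⊥, bot_le⟩ := by
      intro W
      have := fin_of_le W.2
      apply Subtype.ext
      exact Submodule.finrank_eq_zero.1 (h0 W).1
    have huniv : (Finset.univ : Finset (SS 0)) = {⟨⊥, bot_le⟩} := by
      ext W; simp [hbot W]
    rw [MM, huniv, Finset.sum_singleton, (h0 _).1, (h0 _).2]
    interval_cases w <;> interval_cases j <;> rfl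
  | succ k ih =>
    intro w hw j hj
    rw [MM_succ k w j (by omega) hj, ← step_spec k w j (by omega) hw hj]
    apply Finset.sum_congr rfl
    intro v hv
    congr 1
    apply Finset.sum_congr rfl
    intro i hi
    rw [ih (by omega) v (Finset.mem_range.1 hv) i (Finset.mem_range.1 hi)]

noncomputable def LL (a : Fin 11 → ZMod 2) : Polynomial (ZMod 2) →ₗ[ZMod 2] ZMod 2 :=
  ∑ i : Fin 11, a i • Polynomial.lcoeff (ZMod 2) i.val

lemma LL_apply (a : Fin 11 → ZMod 2) (p : Polynomial (ZMod 2)) :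
    LL a p = ∑ i : Fin 11, a i * p.coeff i.val := by
  simp [LL, LinearMap.sum_apply]

lemma LL_low (a : Fin 11 → ZMod 2) (p : Polynomial (ZMod 2)) (hp : p ∈ PD 10) :
    LL a p = ∑ c : Fin 10, a ⟨0 + c.val, by omega⟩ * p.coeff c.val := by
  rw [LL_apply, Fin.sum_univ_castSucc]
  have h : p.coeff 10 = 0 := by
    apply Polynomial.coeff_eq_zero_of_degree_lt
    exact Polynomial.mem_degreeLT.1 hp
  simp only [Fin.val_last, h, mul_zero, add_zero, zero_add]
  rfl

lemma LL_high (a : Fin 11 → ZMod 2) (p : Polynomial (ZMod 2)) :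
    LL a (shiftX p) = ∑ c : Fin 10, a ⟨1 + c.val, by omega⟩ * p.coeff c.val := by
  rw [LL_apply, Fin.sum_univ_succ, shiftX_apply]
  simp only [Fin.val_zero, Polynomial.mul_coeff_zero, Polynomial.coeff_X_zero, zero_mul, mul_zero,
    zero_add, Fin.val_succ, Polynomial.coeff_X_mul]
  apply Finset.sum_congr rfl
  intro c _
  congr 2
  apply Fin.ext
  simp [add_comm]

noncomputable def kerA {n : ℕ} (α : Fin n → Fin 11 → ZMod 2) : PS :=
  PD 10 ⊓ ⨅ j, der (LinearMap.ker (LL (α j)))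

lemma mem_kerA {n : ℕ} (α : Fin n → Fin 11 → ZMod 2) (p : Polynomial (ZMod 2)) :
    p ∈ kerA α ↔ p ∈ PD 10 ∧ ∀ j, LL (α j) p = 0 ∧ LL (α j) (shiftX p) = 0 := by
  simp [kerA, der, Submodule.mem_iInf]

lemma kerA_le {n : ℕ} (α : Fin n → Fin 11 → ZMod 2) : kerA α ≤ PD 10 := inf_le_left

lemma mem_kerA_iff {n : ℕ} (α : Fin n → Fin 11 → ZMod 2) (p : Polynomial (ZMod 2))
    (hp : p ∈ PD 10) : p ∈ kerA α ↔
      (persymMatrix n 10 α).mulVec (fun c : Fin 10 => p.coeff c.val) = 0 := by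
  rw [mem_kerA]
  constructor
  · rintro ⟨-, h⟩
    funext r
    have hr := r.isLt
    have h1 := h ⟨r.val / 2, by omega⟩
    rw [LL_low _ _ hp, LL_high] at h1
    simp only [Matrix.mulVec, dotProduct, persymMatrix, Matrix.of_apply, Pi.zero_apply]
    rcases Nat.mod_two_eq_zero_or_one r.val with h2 | h2
    · simp only [h2]; exact h1.1
    · simp only [h2]; exact h1.2
  · intro h
    refine ⟨hp, fun j => ?_⟩
    have hj := j.isLt
    rw [LL_low _ _ hp, LL_high]
    have ha := congrFun h ⟨2 * j.val, by omega⟩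
    have hb := congrFun h ⟨2 * j.val + 1, by omega⟩
    simp only [Matrix.mulVec, dotProduct, persymMatrix, Matrix.of_apply, Pi.zero_apply] at ha hb
    have e1 : 2 * j.val / 2 = j.val := by omega
    have e2 : 2 * j.val % 2 = 0 := by omega
    have e3 : (2 * j.val + 1) / 2 = j.val := by omega
    have e4 : (2 * j.val + 1) % 2 = 1 := by omega
    simp only [e1, e2] at ha
    simp only [e3, e4] at hb
    exact ⟨ha, hb⟩

lemma fr_kerA {n : ℕ} (α : Fin n → Fin 11 → ZMod 2) :
    (persymMatrix n 10 α).rank + fr (kerA α) = 10 := by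
  have h1 := LinearMap.finrank_range_add_finrank_ker (persymMatrix n 10 α).mulVecLin
  rw [Module.finrank_fintype_fun_eq_card, Fintype.card_fin] at h1
  let φ : (Fin 10 → ZMod 2) →ₗ[ZMod 2] Polynomial (ZMod 2) :=
    (PD 10).subtype ∘ₗ (Polynomial.degreeLTEquiv (ZMod 2) 10).symm.toLinearMap
  have hφ : Function.Injective φ :=
    (PD 10).injective_subtype.comp (Polynomial.degreeLTEquiv (ZMod 2) 10).symm.injective
  have hφ1 : ∀ v, φ v ∈ PD 10 := fun v => ((Polynomial.degreeLTEquiv (ZMod 2) 10).symm v).2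
  have hφ2 : ∀ v, (fun c : Fin 10 => (φ v).coeff c.val) = v := by
    intro v
    exact (Polynomial.degreeLTEquiv (ZMod 2) 10).apply_symm_apply v
  have hk : kerA α = (LinearMap.ker (persymMatrix n 10 α).mulVecLin).map φ := by
    ext p
    constructor
    · intro hp
      have hp1 := kerA_le α hp
      refine ⟨fun c => p.coeff c.val, ?_, ?_⟩
      · exact (mem_kerA_iff α p hp1).1 hp
      · have := (Polynomial.degreeLTEquiv (ZMod 2) 10).symm_apply_apply ⟨p, hp1⟩
        exact congrArg Subtype.val this
    · rintro ⟨v, hv, rfl⟩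
      rw [mem_kerA_iff α _ (hφ1 v), hφ2]
      exact hv
  have h2 : fr (kerA α) = Module.finrank (ZMod 2) (LinearMap.ker (persymMatrix n 10 α).mulVecLin) := by
    rw [hk]
    exact (Submodule.equivMapOfInjective φ hφ _).finrank_eq.symm
  rw [h2]
  exact h1

lemma LL_of (φ : Polynomial (ZMod 2) →ₗ[ZMod 2] ZMod 2) (p : Polynomial (ZMod 2))
    (hp : p ∈ PD 11) : LL (fun i => φ (Polynomial.X ^ i.val)) p = φ p := by
  have h : p = ∑ i : Fin 11, p.coeff i.val • (Polynomial.X : Polynomial (ZMod 2)) ^ i.val := by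
    have hd := Polynomial.mem_degreeLT.1 hp
    ext m
    simp only [Polynomial.finsetSum_coeff, Polynomial.coeff_smul, Polynomial.coeff_X_pow,
      smul_eq_mul, mul_ite, mul_one, mul_zero]
    by_cases hm : m < 11
    · rw [Finset.sum_eq_single ⟨m, hm⟩]
      · simp
      · intro b _ hb
        rw [if_neg]
        intro h
        exact hb (Fin.ext h.symm)
      · simp
    · rw [Finset.sum_eq_zero]
      · apply Polynomial.coeff_eq_zero_of_degree_lt
        refine hd.trans_le ?_
        exact_mod_cast not_lt.1 hm
      · intro b _
        rw [if_neg]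
        have := b.isLt
        omega
  rw [LL_apply]
  conv_rhs => rw [h]
  rw [map_sum]
  apply Finset.sum_congr rfl
  intro i _
  rw [map_smul, smul_eq_mul, mul_comm]

noncomputable def resU (U : PS) : (Fin 11 → ZMod 2) →ₗ[ZMod 2] Module.Dual (ZMod 2) U where
  toFun a := (LL a).domRestrict U
  map_add' a b := by
    ext p
    simp [LL_apply, add_mul, Finset.sum_add_distrib]
  map_smul' c a := by
    ext p
    simp [LL_apply, mul_assoc, Finset.mul_sum]

lemma card_ann (U : PS) (hU : U ≤ PD 11) :
    Nat.card {a : Fin 11 → ZMod 2 // U ≤ LinearMap.ker (LL a)} = 2 ^ (11 - fr U) := by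
  have := fin_of_le hU
  have hs : LinearMap.range (resU U) = ⊤ := by
    rw [LinearMap.range_eq_top]
    intro f
    obtain ⟨g, hg⟩ := LinearMap.exists_extend f
    refine ⟨fun i => g (Polynomial.X ^ i.val), ?_⟩
    ext p
    change LL (fun i : Fin 11 => g (Polynomial.X ^ i.val)) p.1 = f p
    rw [LL_of g p.1 (hU p.2), ← hg]
    rfl
  have h1 := LinearMap.finrank_range_add_finrank_ker (resU U)
  rw [hs, finrank_top, Subspace.dual_finrank_eq, Module.finrank_fintype_fun_eq_card,
    Fintype.card_fin] at h1
  have h2 : Module.finrank (ZMod 2) (LinearMap.ker (resU U)) = 11 - fr U := by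
    unfold fr; omega
  have h3 := Module.natCard_eq_pow_finrank (K := ZMod 2) (V := LinearMap.ker (resU U))
  rw [h2] at h3
  rw [Nat.card_zmod] at h3
  rw [← h3]
  apply Nat.card_congr
  apply Equiv.subtypeEquivRight
  intro a
  rw [LinearMap.mem_ker]
  constructor
  · intro h
    ext p
    exact h p.2
  · intro h p hp
    exact LinearMap.congr_fun h ⟨p, hp⟩

lemma card_alpha (n : ℕ) (W : SS 10) :
    Nat.card {α : Fin n → Fin 11 → ZMod 2 // W.1 ≤ kerA α} =
      (2 ^ n) ^ (11 - (2 * fr W.1 - dd W.1)) := by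
  have h1 : Nat.card {α : Fin n → Fin 11 → ZMod 2 // W.1 ≤ kerA α} =
      Nat.card {α : Fin n → Fin 11 → ZMod 2 // ∀ j, extS W.1 ≤ LinearMap.ker (LL (α j))} := by
    apply Nat.card_congr
    apply Equiv.subtypeEquivRight
    intro α
    simp only [kerA, le_inf_iff, le_iInf_iff, ext_le_iff, W.2, true_and]
  rw [h1, Nat.card_congr (Equiv.subtypePiEquivPi
    (p := fun _ (a : Fin 11 → ZMod 2) => extS W.1 ≤ LinearMap.ker (LL a))), Nat.card_pi]
  simp only [card_ann _ (ext_le_PD W.2), Finset.prod_const, Finset.card_univ, Fintype.card_fin]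
  have h2 := fr_ext W.2
  rw [show fr (extS W.1) = 2 * fr W.1 - dd W.1 by omega, ← pow_mul, ← pow_mul, mul_comm]

open Classical in
lemma count_le {n : ℕ} (α : Fin n → Fin 11 → ZMod 2) (w : ℕ) :
    (Finset.univ.filter fun W : SS 10 => fr W.1 = w ∧ W.1 ≤ kerA α).card = gs (fr (kerA α)) w := by
  have := fin_of_le (kerA_le α)
  have h := card_ic ⊥ (kerA α) bot_le w
  rw [finrank_bot] at h
  simp only [gsI, Nat.zero_le, if_true, Nat.sub_zero] at h
  rw [fr, ← h, ← Fintype.card_subtype, ← Nat.card_eq_fintype_card]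
  apply Nat.card_congr
  exact
    { toFun := fun V => ⟨V.1.1, ⟨bot_le, V.2.2⟩, V.2.1⟩
      invFun := fun V => ⟨⟨V.1, V.2.1.2.trans (kerA_le α)⟩, V.2.2, V.2.1.2⟩
      left_inv := fun V => rfl
      right_inv := fun V => rfl }

open Classical in
lemma sum_alpha (n w : ℕ) :
    ∑ α : Fin n → Fin 11 → ZMod 2, (gs (fr (kerA α)) w : ℤ) =
      ∑ j ∈ Finset.range 11, MM 10 w j * (2 ^ n) ^ (11 - (2 * w - j)) := by
  rw [← sum_group (by norm_num) w (fun j => ((2 ^ n) ^ (11 - (2 * w - j)) : ℤ))]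
  have h1 : ∀ α : Fin n → Fin 11 → ZMod 2, (gs (fr (kerA α)) w : ℤ) =
      ∑ W : SS 10, if fr W.1 = w ∧ W.1 ≤ kerA α then 1 else 0 := by
    intro α
    rw [← count_le, Finset.card_filter]
    push_cast
    rfl
  simp only [h1]
  rw [Finset.sum_comm]
  apply Finset.sum_congr rfl
  intro W _
  by_cases h : fr W.1 = w
  · subst h
    simp only [true_and, if_true]
    have h2 := card_alpha n W
    rw [Nat.card_eq_fintype_card, Fintype.card_subtype, Finset.card_filter] at h2
    exact_mod_cast h2
  · simp [h]

lemma Gamma_eq (n : ℕ) : (Gamma n 10 9 : ℤ) =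
    ∑ w ∈ Finset.range 11, ginv 1 w *
      ∑ j ∈ Finset.range 11, look 10 w j * (2 ^ n) ^ (11 - (2 * w - j)) := by
  classical
  have h1 : (Gamma n 10 9 : ℤ) =
      ∑ α : Fin n → Fin 11 → ZMod 2, if fr (kerA α) = 1 then 1 else 0 := by
    rw [Gamma, Nat.card_eq_fintype_card, Fintype.card_subtype, Finset.card_filter]
    push_cast
    apply Finset.sum_congr rfl
    intro α _
    have := fr_kerA α
    apply if_congr _ rfl rfl
    omega
  have h2 : ∀ α : Fin n → Fin 11 → ZMod 2, (if fr (kerA α) = 1 then (1 : ℤ) else 0) =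
      ∑ w ∈ Finset.range 11, ginv 1 w * (gs (fr (kerA α)) w : ℤ) := by
    intro α
    have := fr_kerA α
    rw [ginv_spec _ _ (by omega) (by norm_num)]
  rw [h1]
  simp only [h2]
  rw [Finset.sum_comm]
  apply Finset.sum_congr rfl
  intro w hw
  rw [← Finset.mul_sum, sum_alpha]
  congr 1
  apply Finset.sum_congr rfl
  intro j hj
  rw [MM_eq 10 le_rfl w (Finset.mem_range.1 hw) j (Finset.mem_range.1 hj)]

lemma ginv_list : (List.range 11).map (ginv 1) =
    [0, 1, -3, 14, -120, 1984, -64512, 4161536, -534773760, 137170518016, -70300024700928] := by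
  decide +kernel

theorem gamma_nine_k_ten (n : ℕ) (hn : 5 ≤ n) :
    (Gamma n 10 9 : ℤ) =
      1023 * 2 ^ (9 * n) - 1533 * 2 ^ (8 * n) - 517650 * 2 ^ (7 * n)
        + 1798320 * 2 ^ (6 * n) + 78214752 * 2 ^ (5 * n) - 559464192 * 2 ^ (4 * n)
        - 783237120 * 2 ^ (3 * n) + 200235 * 2 ^ 16 * 2 ^ (2 * n)
        - 106680 * 2 ^ 18 * 2 ^ n + 480 * 2 ^ 25 := by
  rw [Gamma_eq]
  simp only [Finset.sum_range_succ, Finset.sum_range_zero]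
  have hg := ginv_list
  simp only [List.range, List.range.loop, List.map_cons, List.map_nil, List.cons.injEq,
    and_true] at hg
  obtain ⟨g0, g1, g2, g3, g4, g5, g6, g7, g8, g9, g10⟩ := hg
  rw [g0, g1, g2, g3, g4, g5, g6, g7, g8, g9, g10]
  simp only [look, tab, List.getD_cons_zero, List.getD_cons_succ, List.getD_nil]
  simp only [mul_comm _ n, pow_mul]
  generalize (2 : ℤ) ^ n = x
  norm_num
  ring
end

section
/- For all integers n ≥ 1 and k ≥ 1, the second moment identity holds: Σ_{i=0}^{min(2n,k)} Γ_i(n,k)·2^{2k+3n−2i} = 2^{kn+4n} + 3·(2^k − 1)·2^{kn+2n} + 6·(2^{k−1} − 1)·2^{kn+n} + 2^{kn+2k} − 6·2^{kn+k} + 2^{kn+3} (an identity of integers; equivalently Σ_i Γ_i(n,k)·2^{−2i} = 2^{n+k(n−2)} + 2^{−n+k(n−2)}·(3·2^k − 3) + 2^{−2n+k(n−2)}·(6·2^{k−1} − 6) + 2^{−3n+kn} − 6·2^{n(k−3)−k} + 8·2^{−3n+k(n−2)}). -/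
open Finset

open Polynomial in
/-- The linear polynomial `a + b X`. -/
noncomputable def linp (a b : ZMod 2) : (ZMod 2)[X] :=
  Polynomial.C a + Polynomial.C b * Polynomial.X

open Polynomial in
/-- number of linear syzygies -/
noncomputable def relCount (U V : (ZMod 2)[X]) : ℕ :=
  Nat.card {r : Fin 4 → ZMod 2 // linp (r 0) (r 1) * U + linp (r 2) (r 3) * V = 0}

lemma linp_mul_add (a b c d a' b' c' d' : ZMod 2) :
    linp a b * linp a' b' + linp c d * linp c' d' = 0 ↔
      a * a' + c * c' = 0 ∧ a * b' + b * a' + (c * d' + d * c') = 0 ∧ b * b' + d * d' = 0 := by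
  have e : linp a b * linp a' b' + linp c d * linp c' d' =
      Polynomial.C (b * b' + d * d') * Polynomial.X ^ 2
        + Polynomial.C (a * b' + b * a' + (c * d' + d * c')) * Polynomial.X
        + Polynomial.C (a * a' + c * c') := by
    simp only [linp, map_add, map_mul]; ring
  rw [e]
  constructor
  · intro h
    have h0 := congrArg (fun p => Polynomial.coeff p 0) h
    have h1 := congrArg (fun p => Polynomial.coeff p 1) h
    have h2 := congrArg (fun p => Polynomial.coeff p 2) h
    simp [Polynomial.coeff_X, Polynomial.coeff_C, Polynomial.coeff_X_pow, -map_add, -map_mul] at h0 h1 h2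
    exact ⟨h0, h1, h2⟩
  · rintro ⟨h0, h1, h2⟩
    rw [h0, h1, h2]; simp

lemma linp_const (a : ZMod 2) : linp a 0 = Polynomial.C a := by simp [linp]

open Polynomial in
lemma relCount_zero : relCount 0 0 = 16 := by
  simp [relCount]

open Polynomial in
lemma relCount_mul (a b c d : ZMod 2) (W : (ZMod 2)[X]) (hW : W ≠ 0) :
    relCount (linp a b * W) (linp c d * W) =
      (Finset.univ.filter fun r : Fin 4 → ZMod 2 =>
        r 0 * a + r 2 * c = 0 ∧ r 0 * b + r 1 * a + (r 2 * d + r 3 * c) = 0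
          ∧ r 1 * b + r 3 * d = 0).card := by
  rw [relCount, Nat.card_eq_fintype_card, Fintype.card_subtype]
  congr 1
  ext r
  simp only [Finset.mem_filter, Finset.mem_univ, true_and]
  rw [← linp_mul_add, ← mul_assoc, ← mul_assoc, ← add_mul, mul_eq_zero, or_iff_left hW]

open Polynomial in
lemma relCount_four (a c : ZMod 2) (h : (a, c) ≠ 0) (W : (ZMod 2)[X]) (hW : W ≠ 0) :
    relCount (linp a 0 * W) (linp c 0 * W) = 4 := by
  rw [relCount_mul _ _ _ _ W hW]
  revert a c; decide

open Polynomial in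
lemma relCount_two (a b c d : ZMod 2) (h : a * d + b * c ≠ 0) (W : (ZMod 2)[X]) (hW : W ≠ 0) :
    relCount (linp a b * W) (linp c d * W) = 2 := by
  rw [relCount_mul _ _ _ _ W hW]
  revert a b c d; decide

lemma zmod2_add_eq_zero {a b : Polynomial (ZMod 2)} : a + b = 0 ↔ a = b := by
  rw [add_eq_zero_iff_eq_neg, CharTwo.neg_eq]

set_option synthInstance.maxHeartbeats 400000 in
set_option synthInstance.maxSize 1000 in
lemma dep_factor : ∀ a b c d : ZMod 2, ¬ (a = 0 ∧ b = 0 ∧ c = 0 ∧ d = 0) → a * d + b * c = 0 →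
    ∃ l m s t : ZMod 2, (l, m) ≠ 0 ∧ (s, t) ≠ 0 ∧ a = s * l ∧ b = s * m ∧ c = t * l ∧ d = t * m := by
  decide

lemma linp_ne_zero {a b : ZMod 2} (h : (a, b) ≠ 0) : linp a b ≠ 0 := by
  intro h'
  apply h
  have h0 := congrArg (fun p => Polynomial.coeff p 0) h'
  have h1 := congrArg (fun p => Polynomial.coeff p 1) h'
  simp [linp, Polynomial.coeff_X, Polynomial.coeff_C] at h0 h1
  simp [h0, h1]

lemma linp_smul (s l m : ZMod 2) : linp (s * l) (s * m) = linp l m * Polynomial.C s := by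
  simp [linp]; ring

lemma linp_degree {a b : ZMod 2} (h : b ≠ 0) : (linp a b).natDegree = 1 := by
  rw [linp, add_comm]; exact Polynomial.natDegree_linear h

open Polynomial in
lemma relCount_class (k : ℕ) (U V : (ZMod 2)[X]) (hU : U ∈ degreeLT (ZMod 2) (k + 1))
    (hV : V ∈ degreeLT (ZMod 2) (k + 1)) (h : relCount U V ≠ 1) :
    (U = 0 ∧ V = 0) ∨
    (∃ a c : ZMod 2, (a, c) ≠ 0 ∧ ∃ W ∈ degreeLT (ZMod 2) (k + 1), W ≠ 0 ∧
      U = linp a 0 * W ∧ V = linp c 0 * W) ∨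
    (∃ a b c d : ZMod 2, a * d + b * c ≠ 0 ∧ ∃ W ∈ degreeLT (ZMod 2) k, W ≠ 0 ∧
      U = linp a b * W ∧ V = linp c d * W) := by
  by_cases hz : U = 0 ∧ V = 0
  · exact Or.inl hz
  right
  have hex : ∃ r : Fin 4 → ZMod 2, r ≠ 0 ∧ linp (r 0) (r 1) * U + linp (r 2) (r 3) * V = 0 := by
    by_contra hcon
    push Not at hcon
    apply h
    rw [relCount, Nat.card_eq_one_iff_unique]
    refine ⟨⟨?_⟩, ⟨⟨0, by simp [linp]⟩⟩⟩
    rintro ⟨r, hr⟩ ⟨r', hr'⟩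
    have e1 : r = 0 := by by_contra h0; exact hcon r h0 hr
    have e2 : r' = 0 := by by_contra h0; exact hcon r' h0 hr'
    simp [e1, e2]
  obtain ⟨r, hr0, hr⟩ := hex
  obtain ⟨a, ha⟩ : ∃ a, a = r 0 := ⟨_, rfl⟩
  obtain ⟨b, hb⟩ : ∃ a, a = r 1 := ⟨_, rfl⟩
  obtain ⟨c, hc⟩ : ∃ a, a = r 2 := ⟨_, rfl⟩
  obtain ⟨d, hd⟩ : ∃ a, a = r 3 := ⟨_, rfl⟩
  rw [← ha, ← hb, ← hc, ← hd] at hr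
  have hne : ¬ (a = 0 ∧ b = 0 ∧ c = 0 ∧ d = 0) := by
    rintro ⟨rfl, rfl, rfl, rfl⟩
    apply hr0
    ext i
    fin_cases i
    exacts [ha.symm, hb.symm, hc.symm, hd.symm]
  by_cases hdet : a * d + b * c = 0
  · left
    obtain ⟨l, m, s, t, hlm, hst, rfl, rfl, rfl, rfl⟩ := dep_factor a b c d hne hdet
    rw [linp_smul, linp_smul, mul_assoc, mul_assoc, ← mul_add, mul_eq_zero,
      or_iff_right (linp_ne_zero hlm)] at hr
    have h2 : ∀ x : ZMod 2, x = 0 ∨ x = 1 := by decide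
    rcases h2 s with rfl | rfl <;> rcases h2 t with rfl | rfl
    · exact absurd rfl hst
    · simp at hr
      refine ⟨1, 0, by decide, U, hU, ?_, by simp [linp], by simp [linp, hr]⟩
      rintro rfl; exact hz ⟨rfl, hr⟩
    · simp at hr
      refine ⟨0, 1, by decide, V, hV, ?_, by simp [linp, hr], by simp [linp]⟩
      rintro rfl; exact hz ⟨hr, rfl⟩
    · simp only [map_one, one_mul, zmod2_add_eq_zero] at hr
      refine ⟨1, 1, by decide, V, hV, ?_, by simp [linp, hr], by simp [linp]⟩
      rintro rfl; exact hz ⟨hr, rfl⟩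
  · right
    have hdet1 : a * d + b * c = 1 := by
      have h2 : ∀ x : ZMod 2, x ≠ 0 → x = 1 := by decide
      exact h2 _ hdet
    have hbez : C d * linp a b + C b * linp c d = 1 := by
      have : C d * linp a b + C b * linp c d = C (a * d + b * c) + (C (b * d) * X + C (b * d) * X) := by
        simp only [linp, map_add, map_mul]; ring
      rw [this, hdet1, CharTwo.add_self_eq_zero]; simp
    rw [zmod2_add_eq_zero] at hr
    have eU : U = linp c d * (C d * V + C b * U) := by
      linear_combination (-U) * hbez + C d * hr
    have eV : V = linp a b * (C d * V + C b * U) := by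
      linear_combination (-V) * hbez - C b * hr
    have hW0 : C d * V + C b * U ≠ 0 := by
      intro h0
      rw [h0, mul_zero] at eU eV
      exact hz ⟨eU, eV⟩
    refine ⟨c, d, a, b, ?_, C d * V + C b * U, ?_, hW0, eU, eV⟩
    · intro h0; apply hdet; rw [← h0]; ring
    · generalize C d * V + C b * U = W at *
      have key : ∀ a b P, b ≠ 0 → P ∈ degreeLT (ZMod 2) (k + 1) → P = linp a b * W →
          W ∈ degreeLT (ZMod 2) k := by
        intro a b P hb hP e
        have hl : linp a b ≠ 0 := linp_ne_zero (by simp [hb])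
        have hP0 : P ≠ 0 := by rw [e]; exact mul_ne_zero hl hW0
        rw [mem_degreeLT, ← natDegree_lt_iff_degree_lt hP0, e, natDegree_mul hl hW0, linp_degree hb] at hP
        rw [mem_degreeLT, ← natDegree_lt_iff_degree_lt hW0]
        omega
      by_cases hb0 : b = 0
      · have hd0 : d ≠ 0 := by rintro rfl; simp [hb0] at hdet
        exact key _ _ _ hd0 hU eU
      · exact key _ _ _ hb0 hV eV

instance degreeLT_finite (k : ℕ) : Finite (Polynomial.degreeLT (ZMod 2) k) :=
  Finite.of_equiv _ (Polynomial.degreeLTEquiv (ZMod 2) k).symm.toEquiv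

noncomputable instance degreeLT_fintype (k : ℕ) : Fintype (Polynomial.degreeLT (ZMod 2) k) :=
  Fintype.ofFinite _

lemma degreeLT_card (k : ℕ) : Fintype.card (Polynomial.degreeLT (ZMod 2) k) = 2 ^ k := by
  rw [Fintype.card_congr (Polynomial.degreeLTEquiv (ZMod 2) k).toEquiv]
  simp [ZMod.card]

lemma degreeLT_card_ne (k : ℕ) :
    (Fintype.card {W : Polynomial.degreeLT (ZMod 2) k // W ≠ 0} : ℤ) = 2 ^ k - 1 := by
  classical
  have : Fintype.card {W : Polynomial.degreeLT (ZMod 2) k // W ≠ 0} = 2 ^ k - 1 := by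
    rw [Fintype.card_subtype_compl, degreeLT_card]; simp
  rw [this, Nat.cast_sub Nat.one_le_two_pow]; simp

lemma linp_mul_mem {k : ℕ} (a b : ZMod 2) (W : Polynomial.degreeLT (ZMod 2) k) :
    linp a b * W.1 ∈ Polynomial.degreeLT (ZMod 2) (k + 1) := by
  by_cases h : linp a b * W.1 = 0
  · rw [h]; exact Submodule.zero_mem _
  have hl := left_ne_zero_of_mul h
  have hW := right_ne_zero_of_mul h
  have hm := W.2
  rw [Polynomial.mem_degreeLT, ← Polynomial.natDegree_lt_iff_degree_lt hW] at hm
  rw [Polynomial.mem_degreeLT, ← Polynomial.natDegree_lt_iff_degree_lt h,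
    Polynomial.natDegree_mul hl hW]
  have : (linp a b).natDegree ≤ 1 := by
    rw [linp, add_comm]; exact Polynomial.natDegree_linear_le
  omega

lemma linp_const_mul_mem {k : ℕ} (a : ZMod 2) (W : Polynomial.degreeLT (ZMod 2) k) :
    linp a 0 * W.1 ∈ Polynomial.degreeLT (ZMod 2) k := by
  rw [linp_const, ← Polynomial.smul_eq_C_mul]
  exact Submodule.smul_mem _ _ W.2

abbrev DD (k : ℕ) := Polynomial.degreeLT (ZMod 2) k × Polynomial.degreeLT (ZMod 2) k

/-- parametrization of the pairs with 4 relations -/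
noncomputable def par4 (k : ℕ) (x : {p : ZMod 2 × ZMod 2 // p ≠ 0} ×
    {W : Polynomial.degreeLT (ZMod 2) k // W ≠ 0}) : DD k :=
  (⟨linp x.1.1.1 0 * x.2.1.1, linp_const_mul_mem _ _⟩,
    ⟨linp x.1.1.2 0 * x.2.1.1, linp_const_mul_mem _ _⟩)

/-- parametrization of the pairs with 2 relations -/
noncomputable def par2 (k : ℕ)
    (x : {p : (ZMod 2 × ZMod 2) × (ZMod 2 × ZMod 2) // p.1.1 * p.2.2 + p.1.2 * p.2.1 ≠ 0} ×
    {W : Polynomial.degreeLT (ZMod 2) k // W ≠ 0}) : DD (k + 1) :=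
  (⟨linp x.1.1.1.1 x.1.1.1.2 * x.2.1.1, linp_mul_mem _ _ _⟩,
    ⟨linp x.1.1.2.1 x.1.1.2.2 * x.2.1.1, linp_mul_mem _ _ _⟩)

lemma par_cross {a b c d a' b' c' d' : ZMod 2} {W W' : Polynomial (ZMod 2)} (hW : W ≠ 0)
    (hW' : W' ≠ 0) (h1 : linp a b * W = linp a' b' * W') (h2 : linp c d * W = linp c' d' * W') :
    a * c' + c * a' = 0 ∧ a * d' + b * c' + (c * b' + d * a') = 0 ∧ b * d' + d * b' = 0 := by
  rw [← linp_mul_add, zmod2_add_eq_zero]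
  apply mul_right_cancel₀ (mul_ne_zero hW hW')
  linear_combination linp c' d' * W' * h1 - linp a' b' * W' * h2

lemma par4_inj (k : ℕ) : Function.Injective (par4 k) := by
  rintro ⟨⟨⟨a, c⟩, hp⟩, ⟨⟨W, hWm⟩, hW⟩⟩ ⟨⟨⟨a', c'⟩, hp'⟩, ⟨⟨W', hWm'⟩, hW'⟩⟩ h
  simp only [par4, Prod.mk.injEq, Subtype.mk.injEq] at h
  have hW0 : W ≠ 0 := fun h => hW (by simp [h])
  have hW0' : W' ≠ 0 := fun h => hW' (by simp [h])
  have hc := (par_cross hW0 hW0' h.1 h.2).1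
  have e : a = a' ∧ c = c' := by
    clear h
    revert a c a' c'; decide
  obtain ⟨rfl, rfl⟩ := e
  have : W = W' := by
    by_cases ha : a = 0
    · have : c ≠ 0 := by rintro rfl; simp [ha] at hp
      exact mul_left_cancel₀ (linp_ne_zero (by simp [this])) h.2
    · exact mul_left_cancel₀ (linp_ne_zero (by simp [ha])) h.1
  subst this
  rfl

set_option synthInstance.maxHeartbeats 400000 in
set_option synthInstance.maxSize 1000 in
set_option maxRecDepth 100000 in
lemma par2_aux : ∀ a b c d a' b' c' d' : ZMod 2, a * d + b * c ≠ 0 → a' * d' + b' * c' ≠ 0 →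
    a * c' + c * a' = 0 → a * d' + b * c' + (c * b' + d * a') = 0 → b * d' + d * b' = 0 →
    (a = a' ∧ b = b') ∧ (c = c' ∧ d = d') := by
  decide

lemma par2_inj (k : ℕ) : Function.Injective (par2 k) := by
  rintro ⟨⟨⟨⟨a, b⟩, ⟨c, d⟩⟩, hp⟩, ⟨⟨W, hWm⟩, hW⟩⟩ ⟨⟨⟨⟨a', b'⟩, ⟨c', d'⟩⟩, hp'⟩, ⟨⟨W', hWm'⟩, hW'⟩⟩ h
  simp only [par2, Prod.mk.injEq, Subtype.mk.injEq] at h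
  have hW0 : W ≠ 0 := fun h => hW (by simp [h])
  have hW0' : W' ≠ 0 := fun h => hW' (by simp [h])
  obtain ⟨c1, c2, c3⟩ := par_cross hW0 hW0' h.1 h.2
  obtain ⟨⟨rfl, rfl⟩, ⟨rfl, rfl⟩⟩ := par2_aux _ _ _ _ _ _ _ _ hp hp' c1 c2 c3
  have hab : (a, b) ≠ 0 := by
    intro h0; simp only [Prod.mk_eq_zero] at h0; simp [h0.1, h0.2] at hp
  have : W = W' := mul_left_cancel₀ (linp_ne_zero hab) h.1
  subst this
  rfl

lemma sum_relCount (k n : ℕ) :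
    ∑ p : DD (k + 1), (relCount p.1.1 p.2.1 : ℤ) ^ n =
      16 ^ n + 3 * (2 ^ (k + 1) - 1) * 4 ^ n + 6 * (2 ^ k - 1) * 2 ^ n
        + (4 ^ (k + 1) - 1 - 3 * (2 ^ (k + 1) - 1) - 6 * (2 ^ k - 1)) := by
  classical
  set S4 : Finset (DD (k + 1)) := Finset.univ.image (par4 (k + 1)) with hS4
  set S2 : Finset (DD (k + 1)) := Finset.univ.image (par2 k) with hS2
  have c4 : (S4.card : ℤ) = 3 * (2 ^ (k + 1) - 1) := by
    rw [hS4, Finset.card_image_of_injective _ (par4_inj _), Finset.card_univ, Fintype.card_prod,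
      Nat.cast_mul, degreeLT_card_ne]
    congr 1
  have c2 : (S2.card : ℤ) = 6 * (2 ^ k - 1) := by
    rw [hS2, Finset.card_image_of_injective _ (par2_inj _), Finset.card_univ, Fintype.card_prod,
      Nat.cast_mul, degreeLT_card_ne]
    congr 1
  have v4 : ∀ p ∈ S4, relCount p.1.1 p.2.1 = 4 := by
    intro p hp
    rw [hS4, Finset.mem_image] at hp
    obtain ⟨⟨⟨⟨a, c⟩, hp⟩, ⟨⟨W, hWm⟩, hW⟩⟩, -, rfl⟩ := hp
    exact relCount_four _ _ hp _ (fun h => hW (Subtype.ext h))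
  have v2 : ∀ p ∈ S2, relCount p.1.1 p.2.1 = 2 := by
    intro p hp
    rw [hS2, Finset.mem_image] at hp
    obtain ⟨⟨⟨⟨⟨a, b⟩, ⟨c, d⟩⟩, hp⟩, ⟨⟨W, hWm⟩, hW⟩⟩, -, rfl⟩ := hp
    exact relCount_two _ _ _ _ hp _ (fun h => hW (Subtype.ext h))
  have v16 : ∀ p ∈ ({0} : Finset (DD (k + 1))), relCount p.1.1 p.2.1 = 16 := by
    intro p hp
    rw [Finset.mem_singleton] at hp
    subst hp
    exact relCount_zero
  have v1 : ∀ p, p ∉ ({0} : Finset (DD (k + 1))) → p ∉ S4 → p ∉ S2 →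
      relCount p.1.1 p.2.1 = 1 := by
    intro p h16 h4 h2
    by_contra hne
    rcases relCount_class k _ _ p.1.2 p.2.2 hne with h | h | h
    · apply h16
      rw [Finset.mem_singleton]
      exact Prod.ext (Subtype.ext h.1) (Subtype.ext h.2)
    · obtain ⟨a, c, hac, W, hWm, hW, e1, e2⟩ := h
      apply h4
      rw [hS4, Finset.mem_image]
      exact ⟨⟨⟨(a, c), hac⟩, ⟨⟨W, hWm⟩, fun h => hW (congrArg Subtype.val h)⟩⟩, Finset.mem_univ _,
        Prod.ext (Subtype.ext e1.symm) (Subtype.ext e2.symm)⟩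
    · obtain ⟨a, b, c, d, hac, W, hWm, hW, e1, e2⟩ := h
      apply h2
      rw [hS2, Finset.mem_image]
      exact ⟨⟨⟨((a, b), (c, d)), hac⟩, ⟨⟨W, hWm⟩, fun h => hW (congrArg Subtype.val h)⟩⟩,
        Finset.mem_univ _, Prod.ext (Subtype.ext e1.symm) (Subtype.ext e2.symm)⟩
  have pt : ∀ p : DD (k + 1), (relCount p.1.1 p.2.1 : ℤ) ^ n =
      1 + (if p ∈ ({0} : Finset (DD (k + 1))) then ((16 : ℤ) ^ n - 1) else 0)
        + (if p ∈ S4 then ((4 : ℤ) ^ n - 1) else 0) + (if p ∈ S2 then ((2 : ℤ) ^ n - 1) else 0) := by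
    intro p
    by_cases h16 : p ∈ ({0} : Finset (DD (k + 1)))
    · have r := v16 p h16
      have h4 : p ∉ S4 := fun h => by have := v4 p h; omega
      have h2 : p ∉ S2 := fun h => by have := v2 p h; omega
      rw [if_pos h16, if_neg h4, if_neg h2, r]; push_cast; ring
    by_cases h4 : p ∈ S4
    · have r := v4 p h4
      have h2 : p ∉ S2 := fun h => by have := v2 p h; omega
      rw [if_neg h16, if_pos h4, if_neg h2, r]; push_cast; ring
    by_cases h2 : p ∈ S2
    · have r := v2 p h2
      rw [if_neg h16, if_neg h4, if_pos h2, r]; push_cast; ring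
    rw [if_neg h16, if_neg h4, if_neg h2, v1 p h16 h4 h2]; simp
  rw [Finset.sum_congr rfl (fun p _ => pt p)]
  simp only [Finset.sum_add_distrib, Finset.sum_ite_mem, Finset.univ_inter, Finset.sum_const,
    nsmul_eq_mul, c4, c2, Finset.card_singleton, Finset.card_univ, Fintype.card_prod, degreeLT_card]
  have : (4 : ℤ) ^ (k + 1) = 2 ^ (k + 1) * 2 ^ (k + 1) := by rw [← mul_pow]; norm_num
  rw [this]
  push_cast
  ring

lemma card_ker_mat {m n : Type*} [Fintype m] [Fintype n] [DecidableEq n]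
    (M : Matrix m n (ZMod 2)) :
    Nat.card {v : n → ZMod 2 // M.mulVec v = 0} = 2 ^ (Fintype.card n - M.rank) := by
  have h1 : Nat.card {v : n → ZMod 2 // M.mulVec v = 0} = Nat.card (LinearMap.ker M.mulVecLin) :=
    Nat.card_congr (Equiv.subtypeEquivRight (by intro v; simp))
  have h2 := LinearMap.finrank_range_add_finrank_ker M.mulVecLin
  rw [h1, Module.natCard_eq_pow_finrank (K := ZMod 2), Nat.card_zmod]
  congr 1
  rw [Module.finrank_fintype_fun_eq_card] at h2
  rw [Matrix.rank]
  omega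

/-- coefficient matrix -/
noncomputable def coefMat (k : ℕ) (U V : Polynomial (ZMod 2)) :
    Matrix (Fin 4) (Fin (k + 1)) (ZMod 2) :=
  Matrix.of fun s i => (![U, Polynomial.X * U, V, Polynomial.X * V] s).coeff i

lemma card_coefMat (k : ℕ) (U V : Polynomial (ZMod 2)) (hU : U ∈ Polynomial.degreeLT (ZMod 2) k)
    (hV : V ∈ Polynomial.degreeLT (ZMod 2) k) :
    Nat.card {a : Fin (k + 1) → ZMod 2 // (coefMat k U V).mulVec a = 0} * 16
      = 2 ^ (k + 1) * relCount U V := by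
  have hR : relCount U V =
      Nat.card {r : Fin 4 → ZMod 2 // (coefMat k U V).transpose.mulVec r = 0} := by
    apply Nat.card_congr
    apply Equiv.subtypeEquivRight
    intro r
    have e : ∀ i : Fin (k + 1), (coefMat k U V).transpose.mulVec r i =
        (linp (r 0) (r 1) * U + linp (r 2) (r 3) * V).coeff i := by
      intro i
      simp only [linp, add_mul, Polynomial.coeff_add, mul_assoc, Polynomial.coeff_C_mul]
      simp [Matrix.mulVec, dotProduct, Fin.sum_univ_four, coefMat]
      ring
    constructor
    · intro h
      ext i
      simp [e, h]
    · intro h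
      have hm : linp (r 0) (r 1) * U + linp (r 2) (r 3) * V ∈ Polynomial.degreeLT (ZMod 2) (k + 1) :=
        Submodule.add_mem _ (linp_mul_mem _ _ ⟨U, hU⟩) (linp_mul_mem _ _ ⟨V, hV⟩)
      ext i
      by_cases hi : i < k + 1
      · rw [← e ⟨i, hi⟩, h]; simp
      · rw [Polynomial.mem_degreeLT] at hm
        rw [Polynomial.coeff_eq_zero_of_degree_lt]; · simp
        exact hm.trans_le (by exact_mod_cast not_lt.mp hi)
  rw [hR, card_ker_mat, card_ker_mat, Matrix.rank_transpose]
  simp only [Fintype.card_fin]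
  have h4 : (coefMat k U V).rank ≤ 4 := by simpa using Matrix.rank_le_card_height (coefMat k U V)
  have hk : (coefMat k U V).rank ≤ k + 1 := by simpa using Matrix.rank_le_card_width (coefMat k U V)
  rw [show 16 = 2 ^ 4 by norm_num, ← pow_add, ← pow_add]
  congr 1
  omega

lemma persym_mulVec (n k : ℕ) (α : Fin n → Fin (k + 1) → ZMod 2) (u : Fin k → ZMod 2) :
    (persymMatrix n k α).mulVec u = 0 ↔
      ∀ j, ∑ c, α j c.castSucc * u c = 0 ∧ ∑ c, α j c.succ * u c = 0 := by
  constructor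
  · intro h j
    constructor
    · have := congrFun h ⟨2 * j.1, by omega⟩
      simp only [Matrix.mulVec, dotProduct, persymMatrix, Matrix.of_apply, Pi.zero_apply] at this
      rw [← this]
      apply Finset.sum_congr rfl
      intro c _
      congr 2
      · ext; simp
      · ext; simp
    · have := congrFun h ⟨2 * j.1 + 1, by omega⟩
      simp only [Matrix.mulVec, dotProduct, persymMatrix, Matrix.of_apply, Pi.zero_apply] at this
      rw [← this]
      apply Finset.sum_congr rfl
      intro c _
      congr 2
      · ext; simp; omega
      · ext; simp; omega
  · intro h
    ext r
    have hr := h ⟨r.1 / 2, by omega⟩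
    simp only [Matrix.mulVec, dotProduct, persymMatrix, Matrix.of_apply, Pi.zero_apply]
    rcases Nat.mod_two_eq_zero_or_one r.1 with h0 | h0
    · rw [← hr.1]
      apply Finset.sum_congr rfl
      intro c _
      congr 2
      ext; simp [h0]
    · rw [← hr.2]
      apply Finset.sum_congr rfl
      intro c _
      congr 2
      ext; simp [h0]; omega

lemma coefMat_mulVec (k : ℕ) (U V : Polynomial.degreeLT (ZMod 2) k) (a : Fin (k + 1) → ZMod 2) :
    (coefMat k U.1 V.1).mulVec a = 0 ↔
      (∑ c : Fin k, a c.castSucc * U.1.coeff c = 0 ∧ ∑ c : Fin k, a c.succ * U.1.coeff c = 0) ∧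
      (∑ c : Fin k, a c.castSucc * V.1.coeff c = 0 ∧ ∑ c : Fin k, a c.succ * V.1.coeff c = 0) := by
  have z : ∀ P : Polynomial.degreeLT (ZMod 2) k, P.1.coeff k = 0 := by
    intro P
    apply Polynomial.coeff_eq_zero_of_degree_lt
    exact Polynomial.mem_degreeLT.mp P.2
  have l0 : ∀ P : Polynomial.degreeLT (ZMod 2) k, ∑ i : Fin (k + 1), P.1.coeff i * a i =
      ∑ c : Fin k, a c.castSucc * P.1.coeff c := by
    intro P
    rw [Fin.sum_univ_castSucc]
    simp [z, mul_comm]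
  have l1 : ∀ P : Polynomial.degreeLT (ZMod 2) k,
      ∑ i : Fin (k + 1), (Polynomial.X * P.1).coeff i * a i =
      ∑ c : Fin k, a c.succ * P.1.coeff c := by
    intro P
    rw [Fin.sum_univ_succ]
    simp [mul_comm]
  rw [← l0, ← l0, ← l1, ← l1, funext_iff, Fin.forall_fin_succ, Fin.forall_fin_succ,
    Fin.forall_fin_succ, Fin.forall_fin_succ]
  simp [Matrix.mulVec, dotProduct, coefMat, and_assoc]

lemma card_alpha_s16 (n k : ℕ) (p : DD k) :
    (Nat.card {α : Fin n → Fin (k + 1) → ZMod 2 //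
      (persymMatrix n k α).mulVec (Polynomial.degreeLTEquiv _ _ p.1) = 0 ∧
      (persymMatrix n k α).mulVec (Polynomial.degreeLTEquiv _ _ p.2) = 0}) * 2 ^ (3 * n)
      = 2 ^ (k * n) * relCount p.1.1 p.2.1 ^ n := by
  have h1 : Nat.card {α : Fin n → Fin (k + 1) → ZMod 2 //
      (persymMatrix n k α).mulVec (Polynomial.degreeLTEquiv _ _ p.1) = 0 ∧
      (persymMatrix n k α).mulVec (Polynomial.degreeLTEquiv _ _ p.2) = 0} =
      Nat.card {a : Fin (k + 1) → ZMod 2 // (coefMat k p.1.1 p.2.1).mulVec a = 0} ^ n := by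
    have e1 : Nat.card {α : Fin n → Fin (k + 1) → ZMod 2 //
      (persymMatrix n k α).mulVec (Polynomial.degreeLTEquiv _ _ p.1) = 0 ∧
      (persymMatrix n k α).mulVec (Polynomial.degreeLTEquiv _ _ p.2) = 0} =
      Nat.card {α : Fin n → Fin (k + 1) → ZMod 2 // ∀ j, (coefMat k p.1.1 p.2.1).mulVec (α j) = 0} := by
      apply Nat.card_congr
      apply Equiv.subtypeEquivRight
      intro α
      rw [persym_mulVec, persym_mulVec, ← forall_and]
      apply forall_congr'
      intro j
      rw [coefMat_mulVec]
      rfl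
    rw [e1, Nat.card_congr (Equiv.subtypePiEquivPi
      (p := fun (_ : Fin n) a => (coefMat k p.1.1 p.2.1).mulVec a = 0)), Nat.card_pi]
    simp
  rw [h1]
  have h2 := congrArg (· ^ n) (card_coefMat k _ _ p.1.2 p.2.2)
  simp only [mul_pow] at h2
  apply Nat.eq_of_mul_eq_mul_right (pow_pos (two_pos) n)
  rw [mul_assoc, ← pow_add, show 3 * n + n = 4 * n by ring, pow_mul 2 4 n, show 2 ^ 4 = 16 by norm_num, h2]
  ring

lemma sum_gamma (n k : ℕ) :
    ∑ i ∈ Finset.range (min (2 * n) k + 1), (Gamma n k i : ℤ) * 2 ^ (2 * k + 3 * n - 2 * i)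
      = 2 ^ (k * n) * ∑ p : DD k, (relCount p.1.1 p.2.1 : ℤ) ^ n := by
  classical
  have s1 : ∑ i ∈ Finset.range (min (2 * n) k + 1), Gamma n k i * 2 ^ (2 * k + 3 * n - 2 * i) =
      ∑ α : Fin n → Fin (k + 1) → ZMod 2, 2 ^ (2 * k + 3 * n - 2 * (persymMatrix n k α).rank) := by
    rw [← Finset.sum_fiberwise_of_maps_to (s := Finset.univ)
      (t := Finset.range (min (2 * n) k + 1)) (g := fun α => (persymMatrix n k α).rank)]
    · apply Finset.sum_congr rfl
      intro i _
      rw [Finset.sum_congr rfl (g := fun _ => 2 ^ (2 * k + 3 * n - 2 * i))]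
      · rw [Finset.sum_const, smul_eq_mul, Gamma, Nat.card_eq_fintype_card, Fintype.card_subtype]
      · intro α hα
        rw [(Finset.mem_filter.mp hα).2]
    · intro α _
      have a1 := Matrix.rank_le_card_height (persymMatrix n k α)
      have a2 := Matrix.rank_le_card_width (persymMatrix n k α)
      simp only [Fintype.card_fin] at a1 a2
      rw [Finset.mem_range]
      omega
  have s2 : ∀ α : Fin n → Fin (k + 1) → ZMod 2,
      2 ^ (2 * k + 3 * n - 2 * (persymMatrix n k α).rank) =
      (∑ p : DD k, if (persymMatrix n k α).mulVec (Polynomial.degreeLTEquiv _ _ p.1) = 0 ∧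
      (persymMatrix n k α).mulVec (Polynomial.degreeLTEquiv _ _ p.2) = 0 then 1 else 0)
        * 2 ^ (3 * n) := by
    intro α
    have a2 := Matrix.rank_le_card_width (persymMatrix n k α)
    have c := card_ker_mat (persymMatrix n k α)
    simp only [Fintype.card_fin] at a2 c
    have c' : (∑ P : Polynomial.degreeLT (ZMod 2) k,
        if (persymMatrix n k α).mulVec (Polynomial.degreeLTEquiv _ _ P) = 0 then 1 else 0) =
        2 ^ (k - (persymMatrix n k α).rank) := by
      rw [← c, Nat.card_eq_fintype_card, Fintype.card_subtype, Finset.card_filter]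
      exact Equiv.sum_comp (Polynomial.degreeLTEquiv (ZMod 2) k).toEquiv
        (fun v => if (persymMatrix n k α).mulVec v = 0 then 1 else 0)
    have : ∀ p q : Prop, [Decidable p] → [Decidable q] →
        (if p ∧ q then 1 else 0 : ℕ) = (if p then 1 else 0) * (if q then 1 else 0) := by
      intro p q _ _
      by_cases p <;> by_cases q <;> simp [*]
    have q : (∑ p : DD k, if (persymMatrix n k α).mulVec (Polynomial.degreeLTEquiv _ _ p.1) = 0 ∧
        (persymMatrix n k α).mulVec (Polynomial.degreeLTEquiv _ _ p.2) = 0 then 1 else 0)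
        = 2 ^ (k - (persymMatrix n k α).rank) * 2 ^ (k - (persymMatrix n k α).rank) := by
      rw [← c', Finset.sum_mul_sum, Fintype.sum_prod_type]
      exact Finset.sum_congr rfl fun x _ => Finset.sum_congr rfl fun y _ => this _ _
    rw [q, ← pow_add, ← pow_add]
    congr 1
    omega
  have s3 : ∑ i ∈ Finset.range (min (2 * n) k + 1), Gamma n k i * 2 ^ (2 * k + 3 * n - 2 * i) =
      2 ^ (k * n) * ∑ p : DD k, relCount p.1.1 p.2.1 ^ n := by
    rw [s1, Finset.sum_congr rfl (fun α _ => s2 α), ← Finset.sum_mul, Finset.sum_comm,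
      Finset.sum_mul, Finset.mul_sum]
    apply Finset.sum_congr rfl
    intro p _
    rw [← card_alpha_s16, ← Finset.card_filter, Nat.card_eq_fintype_card, Fintype.card_subtype]
  exact_mod_cast s3

theorem gamma_second_moment (n k : ℕ) (hn : 1 ≤ n) (hk : 1 ≤ k) :
    ∑ i ∈ Finset.range (min (2 * n) k + 1),
        (Gamma n k i : ℤ) * 2 ^ (2 * k + 3 * n - 2 * i)
      = 2 ^ (k * n + 4 * n) + 3 * (2 ^ k - 1) * 2 ^ (k * n + 2 * n)
          + 6 * (2 ^ (k - 1) - 1) * 2 ^ (k * n + n) + 2 ^ (k * n + 2 * k)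
          - 6 * 2 ^ (k * n + k) + 2 ^ (k * n + 3) := by
  obtain ⟨m, rfl⟩ : ∃ m, k = m + 1 := ⟨k - 1, by omega⟩
  rw [sum_gamma, sum_relCount, Nat.add_sub_cancel]
  have e16 : (16 : ℤ) ^ n = 2 ^ (4 * n) := by rw [pow_mul]; norm_num
  have e4 : (4 : ℤ) ^ n = 2 ^ (2 * n) := by rw [pow_mul]; norm_num
  have e4' : (4 : ℤ) ^ (m + 1) = 2 ^ (2 * (m + 1)) := by rw [pow_mul]; norm_num
  rw [e16, e4, e4']
  simp only [pow_add ((2 : ℤ)) ((m + 1) * n)]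
  rw [pow_succ (2 : ℤ) m]
  ring
end
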